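/- arXiv:math/9406224 — 2 statements merged into one kernel-verified Lean document; each statement's English description precedes it below -/
import Mathlib

section
/- Let (γ_n) be a sequence with γ_n > −1/2 such that γ_n/n → c for some c ≥ 0 as n → ∞. Set σ = √(1 + c + √(1+2c)) and ρ = √(1 + c − √(1+2c)), and define f(x) = (1/π)·√((x²−ρ²)(σ²−x²))/|x| for ρ < |x| < σ and f(x) = 0 otherwise. Then for every ξ with −σ ≤ ξ ≤ σ, lim_{n→∞} (1/n)·M^{(γ_n)}(√n·ξ) = ∫_{−σ}^{ξ} f(x) dx. -/
open Filter Topology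

/-- Generalized binomial coefficient C(t, m) = t(t-1)⋯(t-m+1)/m! for real t. -/
noncomputable def genBinom (t : ℝ) (m : ℕ) : ℝ :=
  (∏ i ∈ Finset.range m, (t - (i : ℝ))) / (Nat.factorial m)

/-- Laguerre polynomial L_n^{(α)}. -/
noncomputable def laguerreL (n : ℕ) (α : ℝ) (x : ℝ) : ℝ :=
  ∑ k ∈ Finset.range (n + 1),
    (-1) ^ k * genBinom ((n : ℝ) + α) (n - k) * x ^ k / (Nat.factorial k)

/-- Generalized Hermite polynomial H_n^{(γ)}:
`H_{2m}^{(γ)}(x) = (-1)^m 2^{2m} m! L_m^{(γ-1/2)}(x²)` and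
`H_{2m+1}^{(γ)}(x) = (-1)^m 2^{2m+1} m! x L_m^{(γ-1/2)}(x²)`. -/
noncomputable def hermiteH (n : ℕ) (γ : ℝ) (x : ℝ) : ℝ :=
  if n % 2 = 0 then
    (-1) ^ (n / 2) * 2 ^ n * (Nat.factorial (n / 2)) * laguerreL (n / 2) (γ - 1/2) (x ^ 2)
  else
    (-1) ^ (n / 2) * 2 ^ n * (Nat.factorial (n / 2)) * x * laguerreL (n / 2) (γ - 1/2) (x ^ 2)

/-- Number of zeros of H_n^{(γ)} that are ≤ ξ. -/
noncomputable def hermiteM (n : ℕ) (γ ξ : ℝ) : ℕ :=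
  {x : ℝ | hermiteH n γ x = 0 ∧ x ≤ ξ}.ncard

lemma exists_zero_of_sq_le {u v Q : ℝ → ℝ} {a k : ℝ} (hk : 0 < k)
    (hu : ∀ x ∈ Set.Icc a (a + Real.pi / k), HasDerivAt u (v x) x)
    (hv : ∀ x ∈ Set.Icc a (a + Real.pi / k), HasDerivAt v (-Q x * u x) x)
    (hQ : ∀ x ∈ Set.Icc a (a + Real.pi / k), k ^ 2 ≤ Q x) :
    ∃ x ∈ Set.Ico a (a + Real.pi / k), u x = 0 := by
  have hl : 0 < Real.pi / k := by positivity
  suffices key : ∀ u v : ℝ → ℝ,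
      (∀ x ∈ Set.Icc a (a + Real.pi / k), HasDerivAt u (v x) x) →
      (∀ x ∈ Set.Icc a (a + Real.pi / k), HasDerivAt v (-Q x * u x) x) →
      ¬ ∀ x ∈ Set.Ico a (a + Real.pi / k), 0 < u x by
    by_contra! hne
    have hcont : ContinuousOn u (Set.Ico a (a + Real.pi / k)) := fun x hx =>
      (hu x (Set.Ico_subset_Icc_self hx)).continuousAt.continuousWithinAt
    have hpre : IsPreconnected (Set.Ico a (a + Real.pi / k)) := isPreconnected_Ico
    by_cases hpos : ∀ x ∈ Set.Ico a (a + Real.pi / k), 0 < u x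
    · exact key u v hu hv hpos
    by_cases hneg : ∀ x ∈ Set.Ico a (a + Real.pi / k), 0 < -u x
    · refine key (fun x => -u x) (fun x => -v x) (fun x hx => (hu x hx).neg)
        (fun x hx => ?_) hneg
      exact (hv x hx).neg.congr_deriv (by ring)
    push Not at hpos hneg
    obtain ⟨p, hp, hp'⟩ := hpos
    obtain ⟨q, hq, hq'⟩ := hneg
    obtain ⟨z, hz, hz'⟩ := hpre.intermediate_value hp hq hcont
      (show (0 : ℝ) ∈ Set.Icc (u p) (u q) from ⟨hp', by linarith⟩)
    exact hne z hz hz'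
  intro u v hu hv hpos
  set b := a + Real.pi / k with hb
  have hab : a < b := by linarith
  have hub : 0 ≤ u b := by
    have h : Tendsto u (𝓝[<] b) (𝓝 (u b)) :=
      (hu b (Set.right_mem_Icc.2 hab.le)).continuousAt.continuousWithinAt
    refine ge_of_tendsto h ?_
    filter_upwards [Ico_mem_nhdsLT hab] with x hx using (hpos x hx).le
  have hnonneg : ∀ x ∈ Set.Icc a b, 0 ≤ u x := by
    intro x hx
    rcases hx.2.lt_or_eq with h | h
    · exact (hpos x ⟨hx.1, h⟩).le
    · rwa [h]
  have hsd : ∀ x, HasDerivAt (fun x => Real.sin (k * (x - a))) (k * Real.cos (k * (x - a))) x := by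
    intro x
    have h : HasDerivAt (fun x => k * (x - a)) k x := by
      simpa using ((hasDerivAt_id x).sub_const a).const_mul k
    simpa [mul_comm] using h.sin
  have hcd : ∀ x, HasDerivAt (fun x => k * Real.cos (k * (x - a)))
      (-k ^ 2 * Real.sin (k * (x - a))) x := by
    intro x
    have h : HasDerivAt (fun x => k * (x - a)) k x := by
      simpa using ((hasDerivAt_id x).sub_const a).const_mul k
    exact (h.cos.const_mul k).congr_deriv (by ring)
  have hW : ∀ x ∈ Set.Icc a b, HasDerivAt
      (fun x => v x * Real.sin (k * (x - a)) - u x * (k * Real.cos (k * (x - a))))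
      ((k ^ 2 - Q x) * (u x * Real.sin (k * (x - a)))) x := by
    intro x hx
    exact (((hv x hx).mul (hsd x)).sub ((hu x hx).mul (hcd x))).congr_deriv (by ring)
  have hanti : AntitoneOn
      (fun x => v x * Real.sin (k * (x - a)) - u x * (k * Real.cos (k * (x - a))))
      (Set.Icc a b) := by
    refine antitoneOn_of_hasDerivWithinAt_nonpos (convex_Icc a b)
      (fun x hx => (hW x hx).continuousAt.continuousWithinAt)
      (fun x hx => (hW x (interior_subset hx)).hasDerivWithinAt) (fun x hx => ?_)
    have hx' := interior_subset hx
    have h1 : 0 ≤ Real.sin (k * (x - a)) := by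
      apply Real.sin_nonneg_of_nonneg_of_le_pi
      · exact mul_nonneg hk.le (by linarith [hx'.1])
      · have : x - a ≤ Real.pi / k := by linarith [hx'.2]
        rw [le_div_iff₀ hk] at this
        linarith
    exact mul_nonpos_of_nonpos_of_nonneg (by linarith [hQ x hx'])
      (mul_nonneg (hnonneg x hx') h1)
  have h := hanti (Set.left_mem_Icc.2 hab.le) (Set.right_mem_Icc.2 hab.le) hab.le
  have hkb : k * (b - a) = Real.pi := by rw [hb]; field_simp; ring
  have hua : 0 < u a := hpos a (Set.left_mem_Ico.2 hab)
  simp only [hkb, sub_self, mul_zero, Real.sin_zero, Real.cos_zero, Real.sin_pi, Real.cos_pi] at h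
  nlinarith [mul_pos hua hk, mul_nonneg hub hk.le]

lemma div_sub_one_le_ncard {Z : Set ℝ} {A B l : ℝ} (hl : 0 < l)
    (hfin : (Z ∩ Set.Ico A B).Finite)
    (hZ : ∀ a, A ≤ a → a + l ≤ B → ∃ x ∈ Set.Ico a (a + l), x ∈ Z) :
    (B - A) / l - 1 ≤ (Z ∩ Set.Ico A B).ncard := by
  set N := ⌊(B - A) / l⌋₊ with hN
  have hNlt : (B - A) / l < N + 1 := Nat.lt_floor_add_one _
  have hex : ∀ i : ℕ, i < N → ∃ x ∈ Set.Ico (A + i * l) (A + i * l + l), x ∈ Z := by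
    intro i hi
    have hN1 : 1 ≤ N := by omega
    have h1 : (N : ℝ) ≤ (B - A) / l := by
      apply Nat.floor_le
      by_contra! h
      rw [hN, Nat.floor_of_nonpos h.le] at hN1
      omega
    rw [le_div_iff₀ hl] at h1
    have h2 : (i : ℝ) + 1 ≤ N := by exact_mod_cast hi
    exact hZ _ (by nlinarith [Nat.cast_nonneg (α := ℝ) i]) (by nlinarith)
  choose! z hz hzZ using hex
  have hcard : N ≤ (Z ∩ Set.Ico A B).ncard := by
    have hinj : Set.InjOn z (Finset.range N : Set ℕ) := by
      have hlt : ∀ i j, i < j → j < N → z i < z j := by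
        intro i j hij hj
        have h1 := (hz i (by omega)).2
        have h2 := (hz j hj).1
        have h3 : (i : ℝ) + 1 ≤ j := by exact_mod_cast hij
        nlinarith
      intro i hi j hj hij
      simp only [Finset.coe_range, Set.mem_Iio] at hi hj
      rcases lt_trichotomy i j with h | h | h
      · exact absurd hij (hlt i j h hj).ne
      · exact h
      · exact absurd hij (hlt j i h hi).ne'
    have hsub : z '' (Finset.range N : Set ℕ) ⊆ Z ∩ Set.Ico A B := by
      rintro _ ⟨i, hi, rfl⟩
      simp only [Finset.coe_range, Set.mem_Iio] at hi
      have h1 : (N : ℝ) ≤ (B - A) / l := by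
        apply Nat.floor_le
        by_contra! h
        rw [hN, Nat.floor_of_nonpos h.le] at hi
        omega
      rw [le_div_iff₀ hl] at h1
      have h2 : (i : ℝ) + 1 ≤ N := by exact_mod_cast hi
      have h3 := hz i hi
      refine ⟨hzZ i hi, ?_, ?_⟩
      · nlinarith [h3.1, Nat.cast_nonneg (α := ℝ) i]
      · nlinarith [h3.2]
    have := Set.ncard_le_ncard hsub hfin
    rwa [hinj.ncard_image, Set.ncard_coe_finset, Finset.card_range] at this
  have : (N : ℝ) ≤ (Z ∩ Set.Ico A B).ncard := by exact_mod_cast hcard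
  linarith

open Polynomial in
/-- The Laguerre polynomial `L_m^{(α)}` as an element of `ℝ[X]`. -/
noncomputable def laguerrePoly (m : ℕ) (α : ℝ) : ℝ[X] :=
  ∑ k ∈ Finset.range (m + 1),
    C ((-1) ^ k * genBinom ((m : ℝ) + α) (m - k) / (Nat.factorial k)) * X ^ k

open Polynomial in
lemma coeff_laguerrePoly (m : ℕ) (α : ℝ) (k : ℕ) :
    (laguerrePoly m α).coeff k =
      if k ≤ m then (-1) ^ k * genBinom ((m : ℝ) + α) (m - k) / (Nat.factorial k) else 0 := by
  simp only [laguerrePoly, finsetSum_coeff, coeff_C_mul_X_pow]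
  rw [Finset.sum_ite_eq]
  simp

lemma eval_laguerrePoly (m : ℕ) (α x : ℝ) :
    (laguerrePoly m α).eval x = laguerreL m α x := by
  simp only [laguerrePoly, laguerreL, Polynomial.eval_finsetSum, Polynomial.eval_mul,
    Polynomial.eval_C, Polynomial.eval_pow, Polynomial.eval_X]
  exact Finset.sum_congr rfl fun k _ => by ring

lemma laguerrePoly_ne_zero (m : ℕ) (α : ℝ) : laguerrePoly m α ≠ 0 := by
  intro h
  have h1 := coeff_laguerrePoly m α m
  rw [h] at h1
  have h2 : (Nat.factorial m : ℝ) ≠ 0 := by exact_mod_cast Nat.factorial_ne_zero m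
  simp [genBinom] at h1
  exact div_ne_zero (pow_ne_zero _ (by norm_num)) h2 h1.symm

lemma natDegree_laguerrePoly_le (m : ℕ) (α : ℝ) : (laguerrePoly m α).natDegree ≤ m := by
  rw [Polynomial.natDegree_le_iff_coeff_eq_zero]
  intro k hk
  rw [coeff_laguerrePoly, if_neg (by omega)]

lemma genBinom_succ (t : ℝ) (j : ℕ) :
    (j + 1 : ℝ) * genBinom t (j + 1) = (t - j) * genBinom t j := by
  have : (Nat.factorial j : ℝ) ≠ 0 := by exact_mod_cast Nat.factorial_ne_zero j
  simp only [genBinom, Finset.prod_range_succ, Nat.factorial_succ, Nat.cast_mul, Nat.cast_add,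
    Nat.cast_one]
  field_simp

lemma coeff_laguerrePoly_succ (m : ℕ) (α : ℝ) (k : ℕ) :
    (k + 1 : ℝ) * (k + 1 + α) * (laguerrePoly m α).coeff (k + 1) +
      (m - k) * (laguerrePoly m α).coeff k = 0 := by
  simp only [coeff_laguerrePoly]
  rcases lt_trichotomy k m with h | h | h
  · obtain ⟨j, rfl⟩ : ∃ j, m = k + 1 + j := ⟨m - (k + 1), by omega⟩
    have h1 := genBinom_succ ((k + 1 + j : ℕ) + α) j
    have : (Nat.factorial k : ℝ) ≠ 0 := by exact_mod_cast Nat.factorial_ne_zero k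
    rw [if_pos (by omega), if_pos (by omega), show k + 1 + j - (k + 1) = j by omega,
      show k + 1 + j - k = j + 1 by omega, Nat.factorial_succ]
    push_cast at h1 ⊢
    field_simp
    rw [pow_succ]
    linear_combination (-1) ^ k * h1
  · subst h
    simp
  · rw [if_neg (by omega), if_neg (by omega)]
    simp

open Polynomial in
lemma laguerrePoly_ode (m : ℕ) (α : ℝ) :
    X * derivative (derivative (laguerrePoly m α)) +
      (C (α + 1) - X) * derivative (laguerrePoly m α) + C (m : ℝ) * laguerrePoly m α = 0 := by
  ext k
  have h := coeff_laguerrePoly_succ m α k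
  rcases k with _ | k
  · simp [sub_mul, coeff_derivative] at h ⊢
    linear_combination h
  · simp only [sub_mul, coeff_add, coeff_sub, coeff_X_mul, coeff_C_mul, coeff_derivative,
      coeff_zero]
    push_cast at h ⊢
    linear_combination h

open Polynomial in
lemma hermiteH_zeros (n : ℕ) (γ : ℝ) :
    {x | hermiteH n γ x = 0}.Finite ∧ {x | hermiteH n γ x = 0}.ncard ≤ n := by
  set p : ℝ[X] := X ^ (n % 2) * expand ℝ 2 (laguerrePoly (n / 2) (γ - 1 / 2)) with hp
  have hp0 : p ≠ 0 := mul_ne_zero (pow_ne_zero _ X_ne_zero)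
    ((expand_ne_zero (by norm_num)).2 (laguerrePoly_ne_zero _ _))
  have hdeg : p.natDegree ≤ n := by
    refine natDegree_mul_le.trans ?_
    rw [natDegree_X_pow, natDegree_expand]
    have := natDegree_laguerrePoly_le (n / 2) (γ - 1 / 2)
    omega
  have hsub : {x | hermiteH n γ x = 0} ⊆ (p.roots.toFinset : Set ℝ) := by
    intro x hx
    have hf : (Nat.factorial (n / 2) : ℝ) ≠ 0 := by exact_mod_cast Nat.factorial_ne_zero _
    replace hx : hermiteH n γ x = 0 := hx
    rw [Finset.mem_coe, Multiset.mem_toFinset, mem_roots hp0, IsRoot.def, hp, eval_mul,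
      eval_pow, eval_X, expand_eval, eval_laguerrePoly]
    rw [hermiteH] at hx
    rcases Nat.mod_two_eq_zero_or_one n with h | h
    · rw [if_pos h] at hx
      rw [h, pow_zero, one_mul]
      exact (mul_eq_zero.1 hx).resolve_left (by simp [hf])
    · rw [if_neg (by omega), mul_assoc] at hx
      rw [h, pow_one]
      exact (mul_eq_zero.1 hx).resolve_left (by simp [hf])
  refine ⟨(Finset.finite_toSet _).subset hsub, ?_⟩
  refine (Set.ncard_le_ncard hsub (Finset.finite_toSet _)).trans ?_
  rw [Set.ncard_coe_finset]
  exact (Multiset.toFinset_card_le _).trans ((card_roots' p).trans hdeg)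

lemma hermiteH_eq_zero {n : ℕ} {γ x : ℝ} (h : laguerreL (n / 2) (γ - 1 / 2) (x ^ 2) = 0) :
    hermiteH n γ x = 0 := by
  rw [hermiteH, h]
  simp

open Polynomial in
lemma exists_hermiteH_zero (n : ℕ) (γ : ℝ) {a k : ℝ} (hk : 0 < k)
    (h0 : ∀ x ∈ Set.Icc a (a + Real.pi / k), x ≠ 0)
    (hQ : ∀ x ∈ Set.Icc a (a + Real.pi / k),
      k ^ 2 ≤ 4 * ((n / 2 : ℕ) : ℝ) + 2 * γ + 1 - x ^ 2 - (γ ^ 2 - γ) / x ^ 2) :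
    ∃ x ∈ Set.Ico a (a + Real.pi / k), hermiteH n γ x = 0 := by
  set p := laguerrePoly (n / 2) (γ - 1 / 2) with hp
  set E : ℝ → ℝ := fun x => Real.exp (γ * Real.log x - x ^ 2 / 2) with hE
  have hEd : ∀ x, x ≠ 0 → HasDerivAt E (E x * (γ / x - x)) x := by
    intro x hx
    have h : HasDerivAt (fun x : ℝ => γ * Real.log x - x ^ 2 / 2) (γ / x - x) x := by
      exact (((Real.hasDerivAt_log hx).const_mul γ).sub
        ((hasDerivAt_pow 2 x).div_const 2)).congr_deriv (by simp [div_eq_mul_inv]; ring)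
    exact h.exp
  have hq : ∀ (q : ℝ[X]) (x : ℝ),
      HasDerivAt (fun x => q.eval (x ^ 2)) (2 * x * (derivative q).eval (x ^ 2)) x := by
    intro q x
    have h := (q.hasDerivAt (x ^ 2)).comp x (hasDerivAt_pow 2 x)
    exact h.congr_deriv (by simp; ring)
  obtain ⟨x, hx, hx0⟩ := exists_zero_of_sq_le
    (u := fun x => E x * p.eval (x ^ 2))
    (v := fun x => E x * (2 * x * (derivative p).eval (x ^ 2) + (γ / x - x) * p.eval (x ^ 2)))
    (Q := fun x => 4 * ((n / 2 : ℕ) : ℝ) + 2 * γ + 1 - x ^ 2 - (γ ^ 2 - γ) / x ^ 2) hk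
    (fun x hx => by
      exact ((hEd x (h0 x hx)).mul (hq p x)).congr_deriv (by ring))
    (fun x hx => by
      have hx0 := h0 x hx
      have hode := congrArg (eval (x ^ 2)) (laguerrePoly_ode (n / 2) (γ - 1 / 2))
      rw [← hp] at hode
      simp only [eval_add, eval_mul, eval_sub, eval_X, eval_C, eval_zero] at hode
      have hr : HasDerivAt (fun x : ℝ => γ / x - x) (-γ / x ^ 2 - 1) x := by
        exact (((hasDerivAt_inv hx0).const_mul γ).sub (hasDerivAt_id x)).congr_deriv
          (by field_simp)
      have h2 : HasDerivAt (fun x : ℝ => 2 * x) 2 x := by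
        simpa using (hasDerivAt_id x).const_mul 2
      refine ((hEd x hx0).mul
        ((h2.mul (hq (derivative p) x)).add (hr.mul (hq p x)))).congr_deriv ?_
      simp only [Pi.add_apply, Pi.mul_apply]
      field_simp
      linear_combination (4 * x ^ 2 * E x) * hode)
    hQ
  refine ⟨x, hx, hermiteH_eq_zero ?_⟩
  have hEx : E x ≠ 0 := (Real.exp_pos _).ne'
  rw [← eval_laguerrePoly]
  exact (mul_eq_zero.1 hx0).resolve_left hEx

/-- The limiting density of the zeros, rescaled by `√n`. -/
noncomputable def zeroDensity (c x : ℝ) : ℝ :=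
  Real.sqrt (2 + 2 * c - x ^ 2 - c ^ 2 / x ^ 2) / Real.pi

/-- The number of zeros of `H_n^{(γ)}` in `[√n a, √n b)`. -/
noncomputable def zeroCount (n : ℕ) (γ a b : ℝ) : ℕ :=
  ({x | hermiteH n γ x = 0} ∩ Set.Ico (Real.sqrt n * a) (Real.sqrt n * b)).ncard

lemma zeroDensity_nonneg (c x : ℝ) : 0 ≤ zeroDensity c x := by
  unfold zeroDensity; positivity

lemma zeroDensity_le {c : ℝ} (x : ℝ) :
    zeroDensity c x ≤ Real.sqrt (2 + 2 * c) / Real.pi := by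
  unfold zeroDensity
  have : 0 ≤ c ^ 2 / x ^ 2 := by positivity
  gcongr
  nlinarith [sq_nonneg x]

lemma intervalIntegrable_zeroDensity (c a b : ℝ) :
    IntervalIntegrable (zeroDensity c) MeasureTheory.volume a b := by
  have hm : Measurable (zeroDensity c) := by
    unfold zeroDensity; fun_prop
  refine (intervalIntegrable_const (c := Real.sqrt (2 + 2 * c) / Real.pi)).mono_fun
    hm.aestronglyMeasurable (Filter.Eventually.of_forall fun x => ?_)
  refine (Real.norm_of_nonneg (zeroDensity_nonneg c x)).trans_le ?_
  exact (zeroDensity_le x).trans (le_abs_self _)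

lemma zeroCount_add_le (n : ℕ) (γ : ℝ) {a b c : ℝ} (hab : a ≤ b) (hbc : b ≤ c) :
    zeroCount n γ a b + zeroCount n γ b c ≤ zeroCount n γ a c := by
  unfold zeroCount
  have hfin := (hermiteH_zeros n γ).1
  have h1 := mul_le_mul_of_nonneg_left hab (Real.sqrt_nonneg n)
  have h2 := mul_le_mul_of_nonneg_left hbc (Real.sqrt_nonneg n)
  rw [← Set.ncard_union_eq _ (hfin.inter_of_left _) (hfin.inter_of_left _)]
  · refine Set.ncard_le_ncard ?_ (hfin.inter_of_left _)
    rw [← Set.inter_union_distrib_left, Set.Ico_union_Ico_eq_Ico h1 h2]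
  · exact (Set.Ico_disjoint_Ico_same).mono Set.inter_subset_right Set.inter_subset_right

lemma sub_one_le_zeroCount {n : ℕ} (hn : 0 < n) (γ : ℝ) {a b k : ℝ} (hk : 0 < k)
    (h0 : ∀ t ∈ Set.Icc a b, t ≠ 0)
    (hQ : ∀ t ∈ Set.Icc a b, k ^ 2 ≤ (4 * ((n / 2 : ℕ) : ℝ) + 2 * γ + 1) / n - t ^ 2 -
      ((γ ^ 2 - γ) / n ^ 2) / t ^ 2) :
    n * (k / Real.pi * (b - a)) - 1 ≤ zeroCount n γ a b := by
  have hn' : (0 : ℝ) < n := by exact_mod_cast hn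
  set r := Real.sqrt n with hr
  have hr0 : 0 < r := Real.sqrt_pos.2 hn'
  have hrr : r ^ 2 = n := Real.sq_sqrt hn'.le
  have hmem : ∀ x ∈ Set.Icc (r * a) (r * b), x / r ∈ Set.Icc a b := by
    intro x hx
    exact ⟨by rw [le_div_iff₀ hr0]; linarith [hx.1], by rw [div_le_iff₀ hr0]; linarith [hx.2]⟩
  have h := div_sub_one_le_ncard (Z := {x | hermiteH n γ x = 0}) (A := r * a) (B := r * b)
    (l := Real.pi / (r * k)) (by positivity) ((hermiteH_zeros n γ).1.inter_of_left _) (by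
      intro a' ha' hb'
      refine exists_hermiteH_zero n γ (by positivity) (fun x hx => ?_) (fun x hx => ?_)
      · have := h0 _ (hmem x ⟨ha'.trans hx.1, hx.2.trans hb'⟩)
        rintro rfl
        simp at this
      · have hx' := hmem x ⟨ha'.trans hx.1, hx.2.trans hb'⟩
        have h1 := hQ _ hx'
        have hx0 : x ≠ 0 := by
          rintro rfl
          simpa using h0 _ hx'
        have h2 := mul_le_mul_of_nonneg_left h1 hn'.le
        rw [mul_pow, hrr]
        refine h2.trans_eq ?_
        rw [div_pow, hrr]
        field_simp)
  refine le_trans (le_of_eq ?_) h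
  rw [← hrr]
  field_simp

lemma tendsto_leadingCoeff {γ : ℕ → ℝ} {c : ℝ}
    (hγ : Tendsto (fun n : ℕ => γ n / n) atTop (𝓝 c)) :
    Tendsto (fun n : ℕ => (4 * ((n / 2 : ℕ) : ℝ) + 2 * γ n + 1) / n) atTop (𝓝 (2 + 2 * c)) := by
  have hinv : Tendsto (fun n : ℕ => (1 : ℝ) / n) atTop (𝓝 0) :=
    tendsto_one_div_atTop_nhds_zero_nat
  have hm : Tendsto (fun n : ℕ => (4 * ((n / 2 : ℕ) : ℝ)) / n) atTop (𝓝 2) := by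
    have hlow : Tendsto (fun n : ℕ => 2 - 2 * ((1 : ℝ) / n)) atTop (𝓝 2) := by
      simpa using (hinv.const_mul 2).const_sub 2
    refine tendsto_of_tendsto_of_tendsto_of_le_of_le' hlow tendsto_const_nhds ?_ ?_
    · filter_upwards [eventually_gt_atTop 0] with n hn
      have hn' : (0 : ℝ) < n := by exact_mod_cast hn
      have h : (n : ℝ) ≤ 2 * ((n / 2 : ℕ) : ℝ) + 1 := by
        have : n ≤ 2 * (n / 2) + 1 := by omega
        exact_mod_cast this
      rw [le_div_iff₀ hn']
      field_simp
      linarith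
    · filter_upwards [eventually_gt_atTop 0] with n hn
      have hn' : (0 : ℝ) < n := by exact_mod_cast hn
      have h : 2 * ((n / 2 : ℕ) : ℝ) ≤ n := by
        have : 2 * (n / 2) ≤ n := by omega
        exact_mod_cast this
      rw [div_le_iff₀ hn']
      linarith
  have h := (hm.add (hγ.const_mul 2)).add hinv
  rw [add_zero] at h
  exact h.congr fun n => by ring

lemma tendsto_singularCoeff {γ : ℕ → ℝ} {c : ℝ}
    (hγ : Tendsto (fun n : ℕ => γ n / n) atTop (𝓝 c)) :
    Tendsto (fun n : ℕ => (γ n ^ 2 - γ n) / (n : ℝ) ^ 2) atTop (𝓝 (c ^ 2)) := by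
  have hinv : Tendsto (fun n : ℕ => (1 : ℝ) / n) atTop (𝓝 0) :=
    tendsto_one_div_atTop_nhds_zero_nat
  have h := (hγ.pow 2).sub (hγ.mul hinv)
  rw [mul_zero, sub_zero] at h
  exact h.congr fun n => by ring

lemma eventually_zeroCount_of_oscillation {γ : ℕ → ℝ} {c : ℝ}
    (hγ : Tendsto (fun n : ℕ => γ n / n) atTop (𝓝 c)) {u v e : ℝ} (he : 0 < e)
    (huv : u ≤ v) (h0 : ∀ t ∈ Set.Icc u v, t ≠ 0)
    (hosc : ∀ t ∈ Set.Icc u v, |zeroDensity c t - zeroDensity c u| ≤ e / 3)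
    {ε : ℝ} (hε : 0 < ε) :
    ∀ᶠ n : ℕ in atTop,
      n * ((∫ x in u..v, zeroDensity c x) - e * (v - u) - ε) ≤ zeroCount n (γ n) u v := by
  have hint : ∫ x in u..v, zeroDensity c x ≤ (zeroDensity c u + e / 3) * (v - u) := by
    calc ∫ x in u..v, zeroDensity c x ≤ ∫ _ in u..v, (zeroDensity c u + e / 3) :=
          intervalIntegral.integral_mono_on huv (intervalIntegrable_zeroDensity c u v)
            intervalIntegrable_const fun x hx => by
              linarith [(abs_le.1 (hosc x hx)).2]
      _ = (zeroDensity c u + e / 3) * (v - u) := by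
          rw [intervalIntegral.integral_const, smul_eq_mul, mul_comm]
  have huv' : 0 ≤ v - u := sub_nonneg.2 huv
  by_cases hκ : zeroDensity c u - 2 * e / 3 ≤ 0
  · refine Filter.Eventually.of_forall fun n => ?_
    refine le_trans ?_ (Nat.cast_nonneg _)
    apply mul_nonpos_of_nonneg_of_nonpos (Nat.cast_nonneg _)
    nlinarith
  push Not at hκ
  obtain ⟨K, hK⟩ := (isCompact_Icc (a := u) (b := v)).exists_bound_of_continuousOn
    (f := fun t : ℝ => 1 / t ^ 2)
    (continuousOn_const.div (continuousOn_pow 2) fun t ht => pow_ne_zero 2 (h0 t ht))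
  have hr : 0 < (Real.pi * (e / 3)) ^ 2 := by positivity
  have hlim : Tendsto (fun n : ℕ =>
      |(4 * ((n / 2 : ℕ) : ℝ) + 2 * γ n + 1) / n - (2 + 2 * c)| +
        |(γ n ^ 2 - γ n) / (n : ℝ) ^ 2 - c ^ 2| * K) atTop (𝓝 0) := by
    have h1 := ((tendsto_leadingCoeff hγ).sub_const (2 + 2 * c)).abs
    have h2 := (((tendsto_singularCoeff hγ).sub_const (c ^ 2)).abs).mul_const K
    simpa using h1.add h2
  filter_upwards [hlim.eventually (gt_mem_nhds hr), eventually_gt_atTop 0,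
    eventually_ge_atTop ⌈1 / ε⌉₊] with n hn hn0 hnε
  have hn' : (0 : ℝ) < n := by exact_mod_cast hn0
  have hnε' : 1 ≤ n * ε := by
    have := Nat.ceil_le.1 hnε
    rwa [div_le_iff₀ hε] at this
  have hpi := Real.pi_pos
  have hmain := sub_one_le_zeroCount hn0 (γ n) (a := u) (b := v)
    (k := Real.pi * (zeroDensity c u - 2 * e / 3)) (by positivity) h0 (by
      intro t ht
      set A := (4 * ((n / 2 : ℕ) : ℝ) + 2 * γ n + 1) / n
      set B := (γ n ^ 2 - γ n) / (n : ℝ) ^ 2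
      have hd : zeroDensity c u - e / 3 ≤ zeroDensity c t := by
        linarith [(abs_le.1 (hosc t ht)).1]
      have hφ : (Real.pi * zeroDensity c t) ^ 2 = 2 + 2 * c - t ^ 2 - c ^ 2 / t ^ 2 := by
        have hpos : 0 < zeroDensity c t := by linarith
        have h1 : Real.pi * zeroDensity c t = Real.sqrt (2 + 2 * c - t ^ 2 - c ^ 2 / t ^ 2) := by
          unfold zeroDensity; field_simp
        rw [h1, Real.sq_sqrt]
        by_contra! hneg
        rw [Real.sqrt_eq_zero_of_nonpos hneg.le] at h1
        exact (mul_pos hpi hpos).ne' h1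
      have hKt : 1 / t ^ 2 ≤ K := (le_abs_self _).trans (hK t ht)
      have hB : (B - c ^ 2) * (1 / t ^ 2) ≤ |B - c ^ 2| * K :=
        (mul_le_mul_of_nonneg_right (le_abs_self _) (by positivity)).trans
          (mul_le_mul_of_nonneg_left hKt (abs_nonneg _))
      have hA := neg_abs_le (A - (2 + 2 * c))
      have hsq : (Real.pi * (zeroDensity c u - 2 * e / 3)) ^ 2 + (Real.pi * (e / 3)) ^ 2 ≤
          (Real.pi * zeroDensity c t) ^ 2 := by
        simp only [mul_pow, ← mul_add]
        gcongr
        nlinarith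
      have e1 : B / t ^ 2 = c ^ 2 / t ^ 2 + (B - c ^ 2) * (1 / t ^ 2) := by ring
      rw [e1]
      linarith)
  refine le_trans ?_ hmain
  rw [mul_div_cancel_left₀ _ hpi.ne']
  have : n * ((∫ x in u..v, zeroDensity c x) - e * (v - u)) ≤
      n * ((zeroDensity c u - 2 * e / 3) * (v - u)) :=
    mul_le_mul_of_nonneg_left (by nlinarith) hn'.le
  nlinarith

/-- The asymptotic lower bound for the number of zeros in `[√n a, √n b)`. -/
def ZeroLowerBound (γ : ℕ → ℝ) (c e a b : ℝ) : Prop :=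
  ∀ ε > 0, ∀ᶠ n : ℕ in atTop,
    n * ((∫ x in a..b, zeroDensity c x) - e * (b - a) - ε) ≤ zeroCount n (γ n) a b

lemma ZeroLowerBound.trans {γ : ℕ → ℝ} {c e x y z : ℝ} (hxy : x ≤ y) (hyz : y ≤ z)
    (h1 : ZeroLowerBound γ c e x y) (h2 : ZeroLowerBound γ c e y z) :
    ZeroLowerBound γ c e x z := by
  intro ε hε
  filter_upwards [h1 (ε / 2) (by positivity), h2 (ε / 2) (by positivity)] with n hn1 hn2
  have h3 : (zeroCount n (γ n) x y : ℝ) + zeroCount n (γ n) y z ≤ zeroCount n (γ n) x z := by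
    exact_mod_cast zeroCount_add_le n (γ n) hxy hyz
  rw [← intervalIntegral.integral_add_adjacent_intervals
    (intervalIntegrable_zeroDensity c x y) (intervalIntegrable_zeroDensity c y z)]
  nlinarith

lemma zeroLowerBound_self (γ : ℕ → ℝ) (c e a : ℝ) : ZeroLowerBound γ c e a a := by
  intro ε hε
  refine Filter.Eventually.of_forall fun n => ?_
  refine le_trans ?_ (Nat.cast_nonneg _)
  simp only [intervalIntegral.integral_same, sub_self, mul_zero, zero_sub]
  exact mul_nonpos_of_nonneg_of_nonpos (Nat.cast_nonneg _) (by linarith)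

lemma zeroLowerBound_of_ne_zero {γ : ℕ → ℝ} {c : ℝ}
    (hγ : Tendsto (fun n : ℕ => γ n / n) atTop (𝓝 c)) {a b : ℝ} (hab : a ≤ b)
    (h0 : ∀ t ∈ Set.Icc a b, t ≠ 0) : ZeroLowerBound γ c 0 a b := by
  suffices key : ∀ e > 0, ZeroLowerBound γ c e a b by
    intro ε hε
    have hba : 0 < b - a + 1 := by linarith
    have hnonneg : 0 < ε / (2 * (b - a + 1)) := by positivity
    filter_upwards [key _ hnonneg (ε / 2) (by positivity)] with n hn
    refine le_trans (mul_le_mul_of_nonneg_left ?_ (Nat.cast_nonneg n)) hn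
    have h1 : ε / (2 * (b - a + 1)) * (b - a) ≤ ε / 2 := by
      rw [div_mul_eq_mul_div, div_le_div_iff₀ (by positivity) two_pos]
      nlinarith
    linarith
  intro e he
  have hcont : ContinuousOn (zeroDensity c) (Set.Icc a b) := by
    unfold zeroDensity
    refine ContinuousOn.div_const (Real.continuous_sqrt.comp_continuousOn ?_) _
    refine (continuousOn_const.sub (continuousOn_pow 2)).sub ?_
    exact continuousOn_const.div (continuousOn_pow 2) fun t ht => pow_ne_zero 2 (h0 t ht)
  obtain ⟨δ, hδ, hδ'⟩ := Metric.uniformContinuousOn_iff.1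
    (isCompact_Icc.uniformContinuousOn_of_continuous hcont) (e / 3) (by positivity)
  obtain ⟨N, hN⟩ := exists_nat_gt ((b - a) / δ)
  have hN0 : (0 : ℝ) < N := lt_of_le_of_lt (div_nonneg (by linarith) hδ.le) hN
  set h := (b - a) / N with hh
  have hh0 : 0 ≤ h := div_nonneg (by linarith) hN0.le
  have hNh : N * h = b - a := by rw [hh]; field_simp
  have hhδ : h < δ := by
    rw [hh, div_lt_iff₀ hN0]
    rwa [div_lt_iff₀ hδ, mul_comm] at hN
  have hstep : ∀ j : ℕ, j ≤ N → ZeroLowerBound γ c e a (a + j * h) := by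
    intro j
    induction j with
    | zero =>
      intro _
      simpa using zeroLowerBound_self γ c e a
    | succ j ih =>
      intro hj
      have hj' : (j : ℝ) + 1 ≤ N := by exact_mod_cast hj
      have hjh : 0 ≤ j * h := by positivity
      have hle : a + ((j + 1 : ℕ) : ℝ) * h ≤ b := by push_cast; nlinarith
      have hlt : a + j * h ≤ a + ((j + 1 : ℕ) : ℝ) * h := by push_cast; nlinarith
      refine (ih (by omega)).trans (by linarith) hlt fun ε hε => ?_
      refine eventually_zeroCount_of_oscillation hγ he hlt
        (fun t ht => h0 t ⟨by linarith [ht.1], by linarith [ht.2]⟩) (fun t ht => ?_) hε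
      refine (hδ' t ⟨by linarith [ht.1], by linarith [ht.2]⟩ (a + j * h)
        ⟨by linarith, by linarith⟩ ?_).le
      have h2 := ht.2
      push_cast at h2
      rw [Real.dist_eq, abs_of_nonneg (by linarith [ht.1])]
      linarith
  have := hstep N le_rfl
  rwa [hNh, add_sub_cancel] at this

lemma integral_zeroDensity_le (c : ℝ) {a b : ℝ} (hab : a ≤ b) :
    ∫ x in a..b, zeroDensity c x ≤ Real.sqrt (2 + 2 * c) / Real.pi * (b - a) := by
  calc ∫ x in a..b, zeroDensity c x ≤ ∫ _ in a..b, Real.sqrt (2 + 2 * c) / Real.pi :=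
        intervalIntegral.integral_mono_on hab (intervalIntegrable_zeroDensity c a b)
          intervalIntegrable_const fun x _ => zeroDensity_le x
    _ = _ := by rw [intervalIntegral.integral_const, smul_eq_mul, mul_comm]

lemma exists_integral_zeroDensity_le (c : ℝ) {ε : ℝ} (hε : 0 < ε) :
    ∃ η > 0, ∀ a b, a ≤ b → b - a ≤ η → ∫ x in a..b, zeroDensity c x ≤ ε := by
  set D := Real.sqrt (2 + 2 * c) / Real.pi
  have hD : 0 ≤ D := by positivity
  refine ⟨ε / (D + 1), by positivity, fun a b hab hη => ?_⟩
  have h1 := integral_zeroDensity_le c hab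
  have h2 : ε / (D + 1) * (D + 1) = ε := by field_simp
  have h3 : D * (b - a) ≤ D * (ε / (D + 1)) := mul_le_mul_of_nonneg_left hη hD
  have h4 : 0 < ε / (D + 1) := by positivity
  nlinarith

lemma zeroLowerBound {γ : ℕ → ℝ} {c : ℝ}
    (hγ : Tendsto (fun n : ℕ => γ n / n) atTop (𝓝 c)) {a b : ℝ} (hab : a ≤ b) :
    ZeroLowerBound γ c 0 a b := by
  have hneg : ∀ a ≤ 0, ZeroLowerBound γ c 0 a 0 := by
    intro a ha ε hε
    rcases ha.eq_or_lt with rfl | ha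
    · exact zeroLowerBound_self γ c 0 0 ε hε
    obtain ⟨η, hη, hη'⟩ := exists_integral_zeroDensity_le c (half_pos hε)
    set m := max a (-η)
    have hm0 : m < 0 := max_lt ha (by linarith)
    filter_upwards [zeroLowerBound_of_ne_zero hγ (le_max_left a (-η))
      (fun t ht => (ht.2.trans_lt hm0).ne) (ε / 2) (by positivity)] with n hn
    have h1 : (zeroCount n (γ n) a m : ℝ) + zeroCount n (γ n) m 0 ≤ zeroCount n (γ n) a 0 := by
      exact_mod_cast zeroCount_add_le n (γ n) (le_max_left a (-η)) hm0.le
    have h2 := hη' m 0 hm0.le (by linarith [le_max_right a (-η)])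
    rw [← intervalIntegral.integral_add_adjacent_intervals
      (intervalIntegrable_zeroDensity c a m) (intervalIntegrable_zeroDensity c m 0)]
    have h3 : (0 : ℝ) ≤ zeroCount n (γ n) m 0 := Nat.cast_nonneg _
    have h4 := mul_le_mul_of_nonneg_left h2 (Nat.cast_nonneg (α := ℝ) n)
    linarith
  have hpos : ∀ b, 0 ≤ b → ZeroLowerBound γ c 0 0 b := by
    intro b hb ε hε
    rcases hb.eq_or_lt with rfl | hb
    · exact zeroLowerBound_self γ c 0 0 ε hε
    obtain ⟨η, hη, hη'⟩ := exists_integral_zeroDensity_le c (half_pos hε)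
    set m := min b η
    have hm0 : 0 < m := lt_min hb hη
    filter_upwards [zeroLowerBound_of_ne_zero hγ (min_le_left b η)
      (fun t ht => (hm0.trans_le ht.1).ne') (ε / 2) (by positivity)] with n hn
    have h1 : (zeroCount n (γ n) 0 m : ℝ) + zeroCount n (γ n) m b ≤ zeroCount n (γ n) 0 b := by
      exact_mod_cast zeroCount_add_le n (γ n) hm0.le (min_le_left b η)
    have h2 := hη' 0 m hm0.le (by linarith [min_le_right b η])
    rw [← intervalIntegral.integral_add_adjacent_intervals
      (intervalIntegrable_zeroDensity c 0 m) (intervalIntegrable_zeroDensity c m b)]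
    have h3 : (0 : ℝ) ≤ zeroCount n (γ n) 0 m := Nat.cast_nonneg _
    have h4 := mul_le_mul_of_nonneg_left h2 (Nat.cast_nonneg (α := ℝ) n)
    linarith
  rcases le_or_gt b 0 with hb | hb
  · rcases hb.eq_or_lt with rfl | hb
    · exact hneg a hab
    · exact zeroLowerBound_of_ne_zero hγ hab fun t ht => (ht.2.trans_lt hb).ne
  · rcases le_or_gt a 0 with ha | ha
    · exact (hneg a ha).trans ha hb.le (hpos b hb.le)
    · exact zeroLowerBound_of_ne_zero hγ hab fun t ht => (ha.trans_le ht.1).ne'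

/-- An antiderivative of `zeroDensity c` on the positive part of its support. -/
noncomputable def zeroDensityPrimitive (c w x : ℝ) : ℝ :=
  (Real.sqrt (-(x ^ 2) ^ 2 + 2 * (1 + c) * x ^ 2 - c ^ 2) +
    (1 + c) * Real.arcsin ((x ^ 2 - (1 + c)) / w) -
    c * Real.arcsin (((1 + c) * x ^ 2 - c ^ 2) / (x ^ 2 * w))) / (2 * Real.pi)

lemma hasDerivAt_arcsin_of_one_sub_sq {g : ℝ → ℝ} {g' x r : ℝ} (hg : HasDerivAt g g' x)
    (hr : 0 < r) (h : 1 - g x ^ 2 = r ^ 2) :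
    HasDerivAt (fun x => Real.arcsin (g x)) (g' / r) x := by
  have hr2 : 0 < r ^ 2 := by positivity
  have h1 : g x ≠ -1 := by
    intro h1
    rw [h1] at h
    norm_num at h
    exact hr2.ne' h.symm
  have h2 : g x ≠ 1 := by
    intro h2
    rw [h2] at h
    norm_num at h
    exact hr2.ne' h.symm
  have := (Real.hasDerivAt_arcsin h1 h2).comp x hg
  rw [h, Real.sqrt_sq hr.le] at this
  exact this.congr_deriv (by ring)

lemma hasDerivAt_zeroDensityPrimitive {c w x : ℝ} (hc : 0 ≤ c) (hw : 0 < w)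
    (hw2 : w ^ 2 = 1 + 2 * c) (hx : 0 < x)
    (hP : 0 < -(x ^ 2) ^ 2 + 2 * (1 + c) * x ^ 2 - c ^ 2) :
    HasDerivAt (zeroDensityPrimitive c w) (zeroDensity c x) x := by
  set S := Real.sqrt (-(x ^ 2) ^ 2 + 2 * (1 + c) * x ^ 2 - c ^ 2) with hS
  have hS0 : 0 < S := Real.sqrt_pos.2 hP
  have hS2 : S ^ 2 = -(x ^ 2) ^ 2 + 2 * (1 + c) * x ^ 2 - c ^ 2 := Real.sq_sqrt hP.le
  have hsq : HasDerivAt (fun x : ℝ => x ^ 2) (2 * x) x := by simpa using hasDerivAt_pow 2 x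
  have d1 : HasDerivAt (fun x : ℝ => Real.sqrt (-(x ^ 2) ^ 2 + 2 * (1 + c) * x ^ 2 - c ^ 2))
      ((-4 * x ^ 3 + 4 * (1 + c) * x) / (2 * S)) x := by
    have h : HasDerivAt (fun x : ℝ => -(x ^ 2) ^ 2 + 2 * (1 + c) * x ^ 2 - c ^ 2)
        (-4 * x ^ 3 + 4 * (1 + c) * x) x :=
      (((hsq.pow 2).neg.add (hsq.const_mul (2 * (1 + c)))).sub_const (c ^ 2)).congr_deriv
        (by simp; ring)
    exact h.sqrt hP.ne'
  have d2 : HasDerivAt (fun x : ℝ => Real.arcsin ((x ^ 2 - (1 + c)) / w))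
      ((2 * x / w) / (S / w)) x :=
    hasDerivAt_arcsin_of_one_sub_sq ((hsq.sub_const (1 + c)).div_const w) (by positivity) (by
      rw [div_pow, div_pow, hS2]
      field_simp
      linear_combination hw2)
  have d3 : HasDerivAt
      (fun x : ℝ => c * Real.arcsin (((1 + c) * x ^ 2 - c ^ 2) / (x ^ 2 * w)))
      (2 * c ^ 2 / (x * S)) x := by
    rcases hc.eq_or_lt with rfl | hc
    · simpa using hasDerivAt_const x (0 : ℝ)
    have h : HasDerivAt (fun x : ℝ => ((1 + c) * x ^ 2 - c ^ 2) / (x ^ 2 * w))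
        (2 * c ^ 2 / (x ^ 3 * w)) x :=
      (((hsq.const_mul (1 + c)).sub_const (c ^ 2)).div (hsq.mul_const w)
        (by positivity)).congr_deriv (by field_simp; ring)
    refine ((hasDerivAt_arcsin_of_one_sub_sq (r := c * S / (x ^ 2 * w)) h (by positivity)
      ?_).const_mul c).congr_deriv (by field_simp)
    rw [div_pow, div_pow, mul_pow c, hS2]
    field_simp
    linear_combination x ^ 4 * hw2
  refine (((d1.add (d2.const_mul (1 + c))).sub d3).div_const (2 * Real.pi)).congr_deriv ?_
  have hd : zeroDensity c x = S / x / Real.pi := by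
    unfold zeroDensity
    congr 1
    rw [Real.sqrt_eq_iff_mul_self_eq_of_pos (by positivity), ← sq, div_pow, hS2]
    field_simp
    ring
  rw [hd]
  field_simp
  linear_combination (-4 : ℝ) * hS2

lemma integral_zeroDensity_eq_half {c w σ ρ : ℝ} (hc : 0 ≤ c) (hw : 0 < w)
    (hw2 : w ^ 2 = 1 + 2 * c) (hρ : 0 ≤ ρ) (hρσ : ρ ≤ σ) (hρ2 : ρ ^ 2 = 1 + c - w)
    (hσ2 : σ ^ 2 = 1 + c + w) :
    ∫ x in ρ..σ, zeroDensity c x = 1 / 2 := by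
  have hcont : ContinuousOn (zeroDensityPrimitive c w) (Set.Icc ρ σ) := by
    unfold zeroDensityPrimitive
    refine ContinuousOn.div_const (ContinuousOn.sub (by fun_prop) ?_) _
    rcases hc.eq_or_lt with rfl | hc
    · simpa using continuousOn_const
    have hρ0 : 0 < ρ := by
      rcases hρ.eq_or_lt with rfl | h
      · nlinarith
      · exact h
    refine continuousOn_const.mul (Real.continuous_arcsin.comp_continuousOn
      (ContinuousOn.div (by fun_prop) (by fun_prop) fun x hx => ?_))
    have : 0 < x := hρ0.trans_le hx.1
    positivity
  rw [intervalIntegral.integral_eq_sub_of_hasDerivAt_of_le hρσ hcont (fun x hx => ?_)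
    (intervalIntegrable_zeroDensity c ρ σ)]
  · have hσ0 : 1 + c + w ≠ 0 := by positivity
    have e1 : -(1 + c + w) ^ 2 + 2 * (1 + c) * (1 + c + w) - c ^ 2 = 0 := by
      linear_combination -hw2
    have e2 : -(1 + c - w) ^ 2 + 2 * (1 + c) * (1 + c - w) - c ^ 2 = 0 := by
      linear_combination -hw2
    have e3 : ((1 + c) * (1 + c + w) - c ^ 2) / ((1 + c + w) * w) = 1 := by
      rw [div_eq_one_iff_eq (by positivity)]
      linear_combination -hw2
    have e4 : c * Real.arcsin (((1 + c) * (1 + c - w) - c ^ 2) / ((1 + c - w) * w)) =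
        -(c * (Real.pi / 2)) := by
      rcases hc.eq_or_lt with rfl | hc
      · simp
      have h0 : 1 + c - w ≠ 0 := by
        intro h
        have : w = 1 + c := by linarith
        rw [this] at hw2
        nlinarith
      have : ((1 + c) * (1 + c - w) - c ^ 2) / ((1 + c - w) * w) = -1 := by
        rw [div_eq_iff (by positivity)]
        linear_combination -hw2
      rw [this, Real.arcsin_neg_one]
      ring
    have e5 : (1 + c + w - (1 + c)) / w = 1 := by field_simp; ring
    have e6 : (1 + c - w - (1 + c)) / w = -1 := by field_simp; ring
    simp only [zeroDensityPrimitive, hσ2, hρ2, e1, e2, e3, e4, e5, e6, Real.sqrt_zero,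
      Real.arcsin_one, Real.arcsin_neg_one]
    have := Real.pi_ne_zero
    field_simp
    ring
  · have hx0 : 0 < x := hρ.trans_lt hx.1
    refine hasDerivAt_zeroDensityPrimitive hc hw hw2 hx0 ?_
    have h1 : ρ ^ 2 < x ^ 2 := pow_lt_pow_left₀ hx.1 hρ two_ne_zero
    have h2 : x ^ 2 < σ ^ 2 := pow_lt_pow_left₀ hx.2 hx0.le two_ne_zero
    rw [hρ2] at h1
    rw [hσ2] at h2
    nlinarith [mul_pos (sub_pos.2 h1) (sub_pos.2 h2)]

lemma zeroDensity_eq {c w σ ρ x : ℝ} (hw2 : w ^ 2 = 1 + 2 * c) (hρ : 0 ≤ ρ) (hσ : 0 ≤ σ)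
    (hρ2 : ρ ^ 2 = 1 + c - w) (hσ2 : σ ^ 2 = 1 + c + w) (hρσ : ρ ≤ σ) (hx : x ≠ 0) :
    zeroDensity c x = if ρ < |x| ∧ |x| < σ then
      (1 / Real.pi) * Real.sqrt ((x ^ 2 - ρ ^ 2) * (σ ^ 2 - x ^ 2)) / |x| else 0 := by
  have hP : 2 + 2 * c - x ^ 2 - c ^ 2 / x ^ 2 =
      (x ^ 2 - ρ ^ 2) * (σ ^ 2 - x ^ 2) / x ^ 2 := by
    rw [hρ2, hσ2]
    field_simp
    linear_combination -hw2
  unfold zeroDensity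
  rw [hP]
  split_ifs with h
  · rw [Real.sqrt_div' _ (sq_nonneg x), Real.sqrt_sq_eq_abs]
    ring
  · rw [Real.sqrt_eq_zero_of_nonpos, zero_div]
    apply div_nonpos_of_nonpos_of_nonneg _ (sq_nonneg x)
    by_cases h1 : ρ < |x|
    · have h2 : σ ≤ |x| := not_lt.1 fun h2 => h ⟨h1, h2⟩
      have h3 : σ ^ 2 ≤ x ^ 2 := by rw [← sq_abs x]; gcongr
      have h4 : ρ ^ 2 ≤ x ^ 2 := by rw [← sq_abs x]; gcongr
      exact mul_nonpos_of_nonneg_of_nonpos (by linarith) (by linarith)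
    · have h2 : |x| ≤ ρ := not_lt.1 h1
      have h3 : x ^ 2 ≤ ρ ^ 2 := by rw [← sq_abs x]; gcongr
      have h4 : ρ ^ 2 ≤ σ ^ 2 := by gcongr
      exact mul_nonpos_of_nonpos_of_nonneg (by linarith) (by linarith)

lemma integral_zeroDensity_eq_one {c w σ ρ : ℝ} (hc : 0 ≤ c) (hw : 0 < w)
    (hw2 : w ^ 2 = 1 + 2 * c) (hρ : 0 ≤ ρ) (hρσ : ρ ≤ σ) (hρ2 : ρ ^ 2 = 1 + c - w)
    (hσ2 : σ ^ 2 = 1 + c + w) :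
    ∫ x in (-σ)..σ, zeroDensity c x = 1 := by
  have hpos : ∫ x in (0 : ℝ)..σ, zeroDensity c x = 1 / 2 := by
    rw [← intervalIntegral.integral_add_adjacent_intervals
      (intervalIntegrable_zeroDensity c 0 ρ) (intervalIntegrable_zeroDensity c ρ σ),
      integral_zeroDensity_eq_half hc hw hw2 hρ hρσ hρ2 hσ2]
    have : ∫ x in (0 : ℝ)..ρ, zeroDensity c x = ∫ _ in (0 : ℝ)..ρ, (0 : ℝ) := by
      refine intervalIntegral.integral_congr_ae (Filter.Eventually.of_forall fun x hx => ?_)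
      rw [Set.uIoc_of_le hρ] at hx
      rw [zeroDensity_eq hw2 hρ (hρ.trans hρσ) hρ2 hσ2 hρσ hx.1.ne', if_neg]
      rw [abs_of_pos hx.1]
      exact fun h => absurd hx.2 (not_le.2 h.1)
    rw [this]
    simp
  have hneg : ∫ x in (-σ)..0, zeroDensity c x = 1 / 2 := by
    have h := intervalIntegral.integral_comp_neg (a := 0) (b := σ) (zeroDensity c)
    rw [neg_zero] at h
    rw [← h, ← hpos]
    refine intervalIntegral.integral_congr fun x _ => ?_
    simp [zeroDensity]
  rw [← intervalIntegral.integral_add_adjacent_intervals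
    (intervalIntegrable_zeroDensity c (-σ) 0) (intervalIntegrable_zeroDensity c 0 σ), hpos, hneg]
  norm_num

theorem stmt8 (γ : ℕ → ℝ) (c : ℝ) (hc : 0 ≤ c)
    (hγ : ∀ n, γ n > -(1/2))
    (hγlim : Tendsto (fun n : ℕ => γ n / n) atTop (𝓝 c))
    (σ ρ : ℝ)
    (hσ : σ = Real.sqrt (1 + c + Real.sqrt (1 + 2 * c)))
    (hρ : ρ = Real.sqrt (1 + c - Real.sqrt (1 + 2 * c)))
    (f : ℝ → ℝ)
    (hf : ∀ x, f x = if ρ < |x| ∧ |x| < σ then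
        (1 / Real.pi) * Real.sqrt ((x ^ 2 - ρ ^ 2) * (σ ^ 2 - x ^ 2)) / |x|
      else 0)
    (ξ : ℝ) (hξ1 : -σ ≤ ξ) (hξ2 : ξ ≤ σ) :
    Tendsto (fun n : ℕ => (hermiteM n (γ n) (Real.sqrt (n : ℝ) * ξ) : ℝ) / n)
      atTop (𝓝 (∫ x in (-σ)..ξ, f x)) := by
  obtain ⟨w, hwdef⟩ : ∃ w, w = Real.sqrt (1 + 2 * c) := ⟨_, rfl⟩
  have hw : 0 < w := by rw [hwdef]; positivity
  have hw2 : w ^ 2 = 1 + 2 * c := by rw [hwdef]; exact Real.sq_sqrt (by linarith)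
  rw [← hwdef] at hσ hρ
  have hwc : w ≤ 1 + c := by nlinarith
  have hρ0 : 0 ≤ ρ := by rw [hρ]; positivity
  have hσ0 : 0 ≤ σ := by rw [hσ]; positivity
  have hρ2 : ρ ^ 2 = 1 + c - w := by rw [hρ]; exact Real.sq_sqrt (by linarith)
  have hσ2 : σ ^ 2 = 1 + c + w := by rw [hσ]; exact Real.sq_sqrt (by linarith)
  have hρσ : ρ ≤ σ := by rw [hσ, hρ]; exact Real.sqrt_le_sqrt (by linarith)
  have hfd : ∫ x in (-σ)..ξ, f x = ∫ x in (-σ)..ξ, zeroDensity c x := by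
    refine intervalIntegral.integral_congr_ae ?_
    filter_upwards [MeasureTheory.compl_mem_ae_iff.2
      (MeasureTheory.measure_singleton (μ := MeasureTheory.volume) (0 : ℝ))] with x hx _
    rw [hf, zeroDensity_eq hw2 hρ0 hσ0 hρ2 hσ2 hρσ hx]
  have hone := integral_zeroDensity_eq_one hc hw hw2 hρ0 hρσ hρ2 hσ2
  rw [← intervalIntegral.integral_add_adjacent_intervals
    (intervalIntegrable_zeroDensity c (-σ) ξ) (intervalIntegrable_zeroDensity c ξ σ)] at hone
  rw [hfd, Metric.tendsto_nhds]
  intro ε hε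
  filter_upwards [zeroLowerBound hγlim hξ1 (ε / 2) (half_pos hε),
    zeroLowerBound hγlim hξ2 (ε / 2) (half_pos hε), eventually_gt_atTop 0,
    eventually_gt_atTop ⌈2 / ε⌉₊] with n hL hR hn0 hnε
  have hn : (0 : ℝ) < n := by exact_mod_cast hn0
  have hnε' : 2 < n * ε := by
    have := Nat.lt_of_ceil_lt hnε
    rwa [div_lt_iff₀ hε] at this
  obtain ⟨hfin, hcard⟩ := hermiteH_zeros n (γ n)
  have h1 : (zeroCount n (γ n) (-σ) ξ : ℝ) ≤ hermiteM n (γ n) (Real.sqrt n * ξ) := by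
    refine Nat.cast_le.2 (Set.ncard_le_ncard ?_ (hfin.subset fun x hx => hx.1))
    exact fun x hx => ⟨hx.1, hx.2.2.le⟩
  have h2 : (hermiteM n (γ n) (Real.sqrt n * ξ) : ℝ) + zeroCount n (γ n) ξ σ ≤ n + 1 := by
    have hunion := Set.ncard_union_add_ncard_inter
      {x | hermiteH n (γ n) x = 0 ∧ x ≤ Real.sqrt n * ξ}
      ({x | hermiteH n (γ n) x = 0} ∩ Set.Ico (Real.sqrt n * ξ) (Real.sqrt n * σ))
      (hfin.subset fun x hx => hx.1) (hfin.inter_of_left _)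
    have hu : ({x | hermiteH n (γ n) x = 0 ∧ x ≤ Real.sqrt n * ξ} ∪
        ({x | hermiteH n (γ n) x = 0} ∩
          Set.Ico (Real.sqrt n * ξ) (Real.sqrt n * σ))).ncard ≤ n := by
      refine (Set.ncard_le_ncard ?_ hfin).trans hcard
      rintro x (hx | hx)
      · exact hx.1
      · exact hx.1
    have hi : ({x | hermiteH n (γ n) x = 0 ∧ x ≤ Real.sqrt n * ξ} ∩
        ({x | hermiteH n (γ n) x = 0} ∩
          Set.Ico (Real.sqrt n * ξ) (Real.sqrt n * σ))).ncard ≤ 1 := by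
      rw [← Set.ncard_singleton (Real.sqrt n * ξ)]
      refine Set.ncard_le_ncard ?_ (Set.finite_singleton _)
      exact fun x hx => le_antisymm hx.1.2 hx.2.2.1
    have : hermiteM n (γ n) (Real.sqrt n * ξ) + zeroCount n (γ n) ξ σ ≤ n + 1 := by
      unfold hermiteM zeroCount
      omega
    exact_mod_cast this
  set I := ∫ x in (-σ)..ξ, zeroDensity c x
  have hJ : ∫ x in ξ..σ, zeroDensity c x = 1 - I := by linarith
  rw [hJ] at hR
  rw [Real.dist_eq, abs_lt]
  constructor
  · rw [neg_lt_sub_iff_lt_add, ← sub_lt_iff_lt_add', lt_div_iff₀ hn]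
    nlinarith
  · rw [sub_lt_iff_lt_add, div_lt_iff₀ hn]
    nlinarith
end

section
/- Let (α_n) and (β_n) be sequences with α_n, β_n > −1 such that α_n/n → ∞, β_n/n → ∞ and α_n/β_n → c for some c > 0 as n → ∞. Let r_n and s_n denote, respectively, the smallest and largest zero of P_n^{(α_n,β_n)}. Then lim_{n→∞} √(α_n/n)·(r_n + (α_n−β_n)/(α_n+β_n)) = −4c/(1+c)^{3/2} and lim_{n→∞} √(α_n/n)·(s_n + (α_n−β_n)/(α_n+β_n)) = 4c/(1+c)^{3/2}. Moreover, the closure of the set ⋃_{n≥1} { √(α_n/n)·(x + (α_n−β_n)/(α_n+β_n)) : P_n^{(α_n,β_n)}(x) = 0 } contains the interval [−4c(1+c)^{−3/2}, 4c(1+c)^{−3/2}]. -/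
open Filter Topology

/-- Jacobi polynomial P_n^{(α,β)}. -/
noncomputable def jacobiP (n : ℕ) (α β : ℝ) (x : ℝ) : ℝ :=
  ∑ k ∈ Finset.range (n + 1),
    genBinom ((n : ℝ) + α) (n - k) * genBinom ((n : ℝ) + β) k *
      ((x - 1) / 2) ^ k * ((x + 1) / 2) ^ (n - k)

/-- Number of zeros of P_n^{(α,β)} that are ≤ ξ. -/
noncomputable def jacobiN (n : ℕ) (α β ξ : ℝ) : ℕ :=
  {x : ℝ | jacobiP n α β x = 0 ∧ x ≤ ξ}.ncard

theorem genBinom_succ_mul (t : ℝ) (m : ℕ) :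
    genBinom t (m + 1) * (m + 1) = genBinom t m * (t - m) := by
  unfold genBinom
  rw [Finset.prod_range_succ, Nat.factorial_succ]
  have : (Nat.factorial m : ℝ) ≠ 0 := by positivity
  push_cast
  field_simp

theorem genBinom_pos {t : ℝ} {m : ℕ} (h : (m : ℝ) - 1 < t) : 0 < genBinom t m := by
  refine div_pos (Finset.prod_pos fun i hi => ?_) (by positivity)
  have : (i : ℝ) + 1 ≤ m := by exact_mod_cast Finset.mem_range.mp hi
  linarith

theorem jacobiP_neg (n : ℕ) (α β x : ℝ) :
    jacobiP n α β (-x) = (-1) ^ n * jacobiP n β α x := by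
  unfold jacobiP
  rw [← Finset.sum_range_reflect, Finset.mul_sum]
  refine Finset.sum_congr rfl fun k hk => ?_
  obtain ⟨m, rfl⟩ := Nat.exists_eq_add_of_le (Nat.lt_succ_iff.mp (Finset.mem_range.mp hk))
  have h1 : k + m + 1 - 1 - k = m := by omega
  have h2 : k + m - m = k := by omega
  have h3 : k + m - k = m := by omega
  rw [h1, h2, h3, show (-x - 1) / 2 = -1 * ((x + 1) / 2) by ring,
    show (-x + 1) / 2 = -1 * ((x - 1) / 2) by ring, mul_pow, mul_pow]
  ring

theorem jacobiP_pos_of_one_le {n : ℕ} {α β x : ℝ} (hα : -1 < α) (hβ : -1 < β) (hx : 1 ≤ x) :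
    0 < jacobiP n α β x := by
  have hb : ∀ k ∈ Finset.range (n + 1),
      0 < genBinom ((n : ℝ) + α) (n - k) * genBinom ((n : ℝ) + β) k := by
    intro k hk
    have hk' : k ≤ n := Nat.lt_succ_iff.mp (Finset.mem_range.mp hk)
    have hkr : (k : ℝ) ≤ n := by exact_mod_cast hk'
    refine mul_pos (genBinom_pos ?_) (genBinom_pos (by linarith))
    rw [Nat.cast_sub hk']
    linarith [Nat.cast_nonneg (α := ℝ) k]
  have hp : 0 ≤ (x - 1) / 2 := by linarith
  have hr : 0 < (x + 1) / 2 := by linarith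
  refine Finset.sum_pos' (fun k hk => ?_) ⟨0, by simp, ?_⟩
  · exact mul_nonneg (mul_nonneg (hb k hk).le (pow_nonneg hp _)) (pow_nonneg hr.le _)
  · rw [pow_zero, mul_one]
    exact mul_pos (hb 0 (by simp)) (pow_pos hr _)

theorem contDiff_jacobiP (n : ℕ) (α β : ℝ) : ContDiff ℝ 2 (jacobiP n α β) := by
  unfold jacobiP
  fun_prop

/-- The first derivative of `((x - 1) / 2) ^ k * ((x + 1) / 2) ^ m`. -/
theorem hasDerivAt_jacobi_monomial (k m : ℕ) (x : ℝ) :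
    HasDerivAt (fun x : ℝ => ((x - 1) / 2) ^ k * ((x + 1) / 2) ^ m)
      (k / 2 * (((x - 1) / 2) ^ (k - 1) * ((x + 1) / 2) ^ m) +
        m / 2 * (((x - 1) / 2) ^ k * ((x + 1) / 2) ^ (m - 1))) x := by
  have hp := (((hasDerivAt_id x).sub_const 1).div_const 2).pow k
  have hr := (((hasDerivAt_id x).add_const 1).div_const 2).pow m
  refine (hp.mul hr).congr_deriv ?_
  simp only [id, Pi.pow_apply]
  ring

theorem jacobi_monomial_operator (k m : ℕ) (α β p r : ℝ) :
    -(4 * p * r) * (k / 2 * ((k - 1 : ℕ) / 2 * (p ^ (k - 1 - 1) * r ^ m) +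
          m / 2 * (p ^ (k - 1) * r ^ (m - 1))) +
        m / 2 * (k / 2 * (p ^ (k - 1) * r ^ (m - 1)) +
          (m - 1 : ℕ) / 2 * (p ^ k * r ^ (m - 1 - 1)))) -
      (2 * (α + 1) * r + 2 * (β + 1) * p) *
        (k / 2 * (p ^ (k - 1) * r ^ m) + m / 2 * (p ^ k * r ^ (m - 1))) +
      (k + m) * (k + m + α + β + 1) * (p ^ k * r ^ m) =
    k * (k + α) * (p ^ k * r ^ m - p ^ (k - 1) * r ^ (m + 1)) -
      m * (m + β) * (p ^ (k + 1) * r ^ (m - 1) - p ^ k * r ^ m) := by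
  rcases k with _ | _ | k <;> rcases m with _ | _ | m <;>
    simp only [Nat.add_sub_cancel, Nat.zero_sub] <;> push_cast <;> ring

theorem jacobi_coeff_succ {n k : ℕ} (hk : k < n) (α β : ℝ) :
    genBinom ((n : ℝ) + α) (n - (k + 1)) * genBinom ((n : ℝ) + β) (k + 1) *
        ((k + 1) * (k + 1 + α)) =
      genBinom ((n : ℝ) + α) (n - k) * genBinom ((n : ℝ) + β) k *
        (((n - k : ℕ) : ℝ) * ((n - k : ℕ) + β)) := by
  obtain ⟨m, rfl⟩ := Nat.exists_eq_add_of_lt hk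
  have h1 : k + m + 1 - (k + 1) = m := by omega
  have h2 : k + m + 1 - k = m + 1 := by omega
  rw [h1, h2]
  have e1 := genBinom_succ_mul (((k + m + 1 : ℕ) : ℝ) + α) m
  have e2 := genBinom_succ_mul (((k + m + 1 : ℕ) : ℝ) + β) k
  have e1' : genBinom (((k + m + 1 : ℕ) : ℝ) + α) (m + 1) * (m + 1) =
      genBinom (((k + m + 1 : ℕ) : ℝ) + α) m * (k + 1 + α) := by
    rw [e1]; push_cast; ring
  have e2' : genBinom (((k + m + 1 : ℕ) : ℝ) + β) (k + 1) * (k + 1) =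
      genBinom (((k + m + 1 : ℕ) : ℝ) + β) k * (m + 1 + β) := by
    rw [e2]; push_cast; ring
  generalize genBinom (((k + m + 1 : ℕ) : ℝ) + α) (m + 1) = a at *
  generalize genBinom (((k + m + 1 : ℕ) : ℝ) + α) m = b at *
  generalize genBinom (((k + m + 1 : ℕ) : ℝ) + β) (k + 1) = d at *
  generalize genBinom (((k + m + 1 : ℕ) : ℝ) + β) k = e at *
  push_cast
  linear_combination b * (k + 1 + α) * e2' - e * (m + 1 + β) * e1'

/-- The Jacobi differential equation. -/
theorem jacobiP_ode (n : ℕ) (α β x : ℝ) :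
    (1 - x ^ 2) * deriv (deriv (jacobiP n α β)) x +
      (β - α - (α + β + 2) * x) * deriv (jacobiP n α β) x +
      n * (n + α + β + 1) * jacobiP n α β x = 0 := by
  set b : ℕ → ℝ := fun k => genBinom ((n : ℝ) + α) (n - k) * genBinom ((n : ℝ) + β) k with hb
  set M : ℕ → ℕ → ℝ → ℝ := fun k m x => ((x - 1) / 2) ^ k * ((x + 1) / 2) ^ m with hM
  have hdM : ∀ k m x, HasDerivAt (M k m) (k / 2 * M (k - 1) m x + m / 2 * M k (m - 1) x) x :=
    hasDerivAt_jacobi_monomial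
  have h0 : jacobiP n α β = fun x => ∑ k ∈ Finset.range (n + 1), b k * M k (n - k) x := by
    funext x
    exact Finset.sum_congr rfl fun k _ => by simp only [hb, hM]; ring
  have h1 : deriv (jacobiP n α β) = fun x => ∑ k ∈ Finset.range (n + 1),
      b k * (k / 2 * M (k - 1) (n - k) x + (n - k : ℕ) / 2 * M k (n - k - 1) x) := by
    funext x
    rw [h0]
    exact (HasDerivAt.fun_sum fun k _ => (hdM k (n - k) x).const_mul (b k)).deriv
  have h2 : deriv (deriv (jacobiP n α β)) x = ∑ k ∈ Finset.range (n + 1),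
      b k * (k / 2 * ((k - 1 : ℕ) / 2 * M (k - 1 - 1) (n - k) x +
          (n - k : ℕ) / 2 * M (k - 1) (n - k - 1) x) +
        (n - k : ℕ) / 2 * (k / 2 * M (k - 1) (n - k - 1) x +
          (n - k - 1 : ℕ) / 2 * M k (n - k - 1 - 1) x)) := by
    rw [h1]
    exact (HasDerivAt.fun_sum fun k _ => (((hdM (k - 1) (n - k) x).const_mul _).add
      ((hdM k (n - k - 1) x).const_mul _)).const_mul (b k)).deriv
  rw [h2, h1, h0]
  simp only [Finset.mul_sum]
  rw [← Finset.sum_add_distrib, ← Finset.sum_add_distrib]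
  set F : ℕ → ℝ := fun k =>
    b k * (k * (k + α)) * (M k (n - k) x - M (k - 1) (n - k + 1) x) with hF
  set G : ℕ → ℝ := fun k =>
    b k * ((n - k : ℕ) * ((n - k : ℕ) + β)) * (M (k + 1) (n - k - 1) x - M k (n - k) x) with hG
  have hFG : ∀ k ∈ Finset.range n, F (k + 1) = G k := by
    intro k hk
    have hk' := Finset.mem_range.mp hk
    have := jacobi_coeff_succ hk' α β
    have h3 : n - (k + 1) + 1 = n - k := by omega
    have h4 : n - (k + 1) = n - k - 1 := by omega
    simp only [hF, hG, hb, Nat.add_sub_cancel, h3]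
    rw [← this, h4]
    push_cast
    ring
  calc _ = ∑ k ∈ Finset.range (n + 1), (F k - G k) := by
        refine Finset.sum_congr rfl fun k hk => ?_
        have hk' : k ≤ n := Nat.lt_succ_iff.mp (Finset.mem_range.mp hk)
        have hn : (n : ℝ) = k + (n - k : ℕ) := by rw [Nat.cast_sub hk']; ring
        have := jacobi_monomial_operator k (n - k) α β ((x - 1) / 2) ((x + 1) / 2)
        rw [← hn] at this
        simp only [hF, hG, hM]
        linear_combination b k * this
    _ = 0 := by
        rw [Finset.sum_sub_distrib, Finset.sum_range_succ', Finset.sum_range_succ G,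
          Finset.sum_congr rfl hFG]
        simp [hF, hG]

theorem hasDerivAt_jacobiP (n : ℕ) (α β x : ℝ) :
    HasDerivAt (jacobiP n α β) (deriv (jacobiP n α β) x) x :=
  ((contDiff_jacobiP n α β).differentiable (by norm_num) x).hasDerivAt

theorem hasDerivAt_deriv_jacobiP (n : ℕ) (α β x : ℝ) :
    HasDerivAt (deriv (jacobiP n α β)) (deriv (deriv (jacobiP n α β)) x) x := by
  have h : ContDiff ℝ 1 (deriv (jacobiP n α β)) :=
    ((contDiff_succ_iff_deriv (n := 1)).mp (contDiff_jacobiP n α β)).2.2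
  exact (h.differentiable (by norm_num) x).hasDerivAt

/-- With `u = (1 - x) ^ ((α + 1) / 2) * (1 + x) ^ ((β + 1) / 2) * jacobiP n α β x`, the Jacobi
equation becomes `u'' + jacobiQ n α β x / (4 * (1 - x ^ 2) ^ 2) * u = 0`. -/
noncomputable def jacobiQ (n : ℕ) (α β x : ℝ) : ℝ :=
  (4 * n * (n + α + β + 1) + 2 * (α + β)) * (1 - x ^ 2) + 4 - ((α + β) * x + (α - β)) ^ 2

theorem jacobiP_ne_zero_of_jacobiQ_nonpos {n : ℕ} {α β x₀ : ℝ} (hα : -1 < α) (hβ : -1 < β)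
    (h₀ : -1 < x₀) (h₁ : x₀ < 1) (hQ : ∀ x, x₀ < x → x < 1 → jacobiQ n α β x ≤ 0) :
    jacobiP n α β x₀ ≠ 0 := by
  intro hz
  set y := jacobiP n α β with hy
  set ψ : ℝ → ℝ := fun x => (β - α - (α + β + 2) * x) / 2 with hψ
  set G : ℝ → ℝ := fun x => (1 - x ^ 2) * (y x * deriv y x) + ψ x * y x ^ 2 with hG
  set W : ℝ → ℝ := fun x => Real.exp (α * Real.log (1 - x) + β * Real.log (1 + x)) with hW
  have hψd : ∀ x, HasDerivAt ψ (-(α + β + 2) / 2) x := fun x =>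
    ((((hasDerivAt_id x).const_mul (α + β + 2)).const_sub (β - α)).div_const 2).congr_deriv
      (by ring)
  have hSd : ∀ x : ℝ, HasDerivAt (fun x : ℝ => 1 - x ^ 2) (-(2 * x)) x := fun x =>
    ((hasDerivAt_pow 2 x).const_sub 1).congr_deriv (by simp)
  have hGd : ∀ x, HasDerivAt G (-(2 * x) * (y x * deriv y x) +
      (1 - x ^ 2) * (deriv y x * deriv y x + y x * deriv (deriv y) x) +
      (-(α + β + 2) / 2 * y x ^ 2 + ψ x * (2 * y x * deriv y x))) x := by
    intro x
    have h1 := hasDerivAt_jacobiP n α β x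
    have h2 := hasDerivAt_deriv_jacobiP n α β x
    refine (((hSd x).mul (h1.mul h2)).add ((hψd x).mul (h1.pow 2))).congr_deriv ?_
    simp only [Pi.mul_apply, Pi.pow_apply, hy]
    ring
  have hWd : ∀ x, -1 < x → x < 1 →
      HasDerivAt W (W x * ((β - α - (α + β) * x) / (1 - x ^ 2))) x := by
    intro x hx hx'
    have e1 : 1 - x ≠ 0 := by linarith
    have e2 : 1 + x ≠ 0 := by linarith
    have h1 := ((hasDerivAt_id x).const_sub 1).log e1
    have h2 := ((hasDerivAt_id x).const_add 1).log e2
    refine ((h1.const_mul α).add (h2.const_mul β)).exp.congr_deriv ?_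
    have e3 : 1 - x ^ 2 ≠ 0 := by
      rw [show 1 - x ^ 2 = (1 - x) * (1 + x) by ring]; exact mul_ne_zero e1 e2
    simp only [hW, id, Pi.add_apply]
    congr 1
    field_simp
    ring
  have hmono : MonotoneOn (fun x => W x * G x) (Set.Ico x₀ 1) := by
    have hd : ∀ x, -1 < x → x < 1 → HasDerivAt (fun x => W x * G x) _ x :=
      fun x hx hx' => (hWd x hx hx').mul (hGd x)
    refine monotoneOn_of_deriv_nonneg (convex_Ico _ _)
      (fun x hx => (hd x (h₀.trans_le hx.1) hx.2).continuousAt.continuousWithinAt) ?_ ?_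
    · rw [interior_Ico]
      exact fun x hx => (hd x (h₀.trans hx.1) hx.2).differentiableAt.differentiableWithinAt
    · rw [interior_Ico]
      intro x hx
      have hx1 : -1 < x := h₀.trans hx.1
      have hS : 0 < 1 - x ^ 2 := by nlinarith [hx.2]
      rw [(hd x hx1 hx.2).deriv]
      have hode := jacobiP_ode n α β x
      rw [← hy] at hode
      have key : W x * ((β - α - (α + β) * x) / (1 - x ^ 2)) * G x + W x *
          (-(2 * x) * (y x * deriv y x) +
            (1 - x ^ 2) * (deriv y x * deriv y x + y x * deriv (deriv y) x) +
            (-(α + β + 2) / 2 * y x ^ 2 + ψ x * (2 * y x * deriv y x))) =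
          W x / (1 - x ^ 2) * (((1 - x ^ 2) * deriv y x + ψ x * y x) ^ 2 +
            -jacobiQ n α β x / 4 * y x ^ 2) := by
        simp only [hG, hψ, jacobiQ]
        field_simp
        linear_combination 16 * W x * (1 - x ^ 2) * y x * hode
      rw [key]
      have := hQ x hx.1 hx.2
      have hWpos : 0 < W x := Real.exp_pos _
      refine mul_nonneg (by positivity) (add_nonneg (sq_nonneg _) (mul_nonneg ?_ (sq_nonneg _)))
      linarith
  have hG0 : G x₀ = 0 := by simp [hG, hz]
  have hGnn : ∀ x ∈ Set.Ioo x₀ 1, 0 ≤ G x := by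
    intro x hx
    have := hmono ⟨le_rfl, h₁⟩ ⟨hx.1.le, hx.2⟩ hx.1.le
    simp only [hG0, mul_zero] at this
    exact nonneg_of_mul_nonneg_right this (Real.exp_pos _)
  have hlim : Tendsto G (𝓝[<] 1) (𝓝 (G 1)) := (hGd 1).continuousAt.continuousWithinAt
  have hG1 : 0 ≤ G 1 :=
    ge_of_tendsto hlim (by
      filter_upwards [Ioo_mem_nhdsLT h₁] with x hx using hGnn x hx)
  have hG1' : G 1 = -((α + 1) * y 1 ^ 2) := by simp only [hG, hψ]; ring
  have hy1 : 0 < y 1 := jacobiP_pos_of_one_le hα hβ le_rfl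
  have : 0 < (α + 1) * y 1 ^ 2 := mul_pos (by linarith) (by positivity)
  linarith

/-- Sturm comparison for the Jacobi equation. -/
theorem exists_jacobiP_eq_zero_of_le_jacobiQ {n : ℕ} {α β a b m : ℝ} (ha : -1 < a) (hab : a ≤ b)
    (hb : b < 1) (hm : 0 < m) (hQ : ∀ x ∈ Set.Icc a b, 4 * m ^ 2 ≤ jacobiQ n α β x)
    (hlen : Real.pi ≤ m * (b - a)) : ∃ x ∈ Set.Icc a b, jacobiP n α β x = 0 := by
  by_contra! hne
  set y := jacobiP n α β with hy
  set ψ : ℝ → ℝ := fun x => (β - α - (α + β + 2) * x) / 2 with hψ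
  set v : ℝ → ℝ := fun x => ((1 - x ^ 2) * deriv y x + ψ x * y x) / ((1 - x ^ 2) * y x) with hv
  have hψd : ∀ x, HasDerivAt ψ (-(α + β + 2) / 2) x := fun x =>
    ((((hasDerivAt_id x).const_mul (α + β + 2)).const_sub (β - α)).div_const 2).congr_deriv
      (by ring)
  have hSd : ∀ x : ℝ, HasDerivAt (fun x : ℝ => 1 - x ^ 2) (-(2 * x)) x := fun x =>
    ((hasDerivAt_pow 2 x).const_sub 1).congr_deriv (by simp)
  have hS : ∀ x ∈ Set.Icc a b, 0 < 1 - x ^ 2 := fun x hx => by nlinarith [hx.1, hx.2]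
  have hvd : ∀ x ∈ Set.Icc a b,
      HasDerivAt v (-jacobiQ n α β x / (4 * (1 - x ^ 2) ^ 2) - v x ^ 2) x := by
    intro x hx
    have h1 := hasDerivAt_jacobiP n α β x
    have h2 := hasDerivAt_deriv_jacobiP n α β x
    have hSx := (hS x hx).ne'
    have hyx := hne x hx
    have hode := jacobiP_ode n α β x
    refine ((((hSd x).mul h2).add ((hψd x).mul h1)).div ((hSd x).mul h1)
      (mul_ne_zero hSx hyx)).congr_deriv ?_
    simp only [Pi.mul_apply, Pi.add_apply, ← hy, hv, hψ, jacobiQ] at hode ⊢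
    field_simp
    linear_combination 16 * (1 - x ^ 2) * y x * hode
  have hgd : ∀ x ∈ Set.Icc a b, HasDerivAt (fun x => Real.arctan (v x / m) + m * x)
      (1 / (1 + (v x / m) ^ 2) *
        ((-jacobiQ n α β x / (4 * (1 - x ^ 2) ^ 2) - v x ^ 2) / m) + m * 1) x := fun x hx =>
    ((hvd x hx).div_const m).arctan.add ((hasDerivAt_id x).const_mul m)
  have hanti : AntitoneOn (fun x => Real.arctan (v x / m) + m * x) (Set.Icc a b) := by
    refine antitoneOn_of_deriv_nonpos (convex_Icc _ _)
      (fun x hx => (hgd x hx).continuousAt.continuousWithinAt)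
      (fun x hx => (hgd x (interior_subset hx)).differentiableAt.differentiableWithinAt) ?_
    intro x hx
    have hx := interior_subset hx
    rw [(hgd x hx).deriv]
    have hSx := hS x hx
    have hq : m ^ 2 ≤ jacobiQ n α β x / (4 * (1 - x ^ 2) ^ 2) := by
      rw [le_div_iff₀ (by positivity)]
      have : (1 - x ^ 2) ^ 2 ≤ 1 := by nlinarith [sq_nonneg x]
      nlinarith [hQ x hx, mul_nonneg (sq_nonneg m) (sub_nonneg.mpr this)]
    have e : 1 / (1 + (v x / m) ^ 2) *
        ((-jacobiQ n α β x / (4 * (1 - x ^ 2) ^ 2) - v x ^ 2) / m) + m * 1 =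
        m / (m ^ 2 + v x ^ 2) * (m ^ 2 - jacobiQ n α β x / (4 * (1 - x ^ 2) ^ 2)) := by
      rw [neg_div]
      generalize jacobiQ n α β x / (4 * (1 - x ^ 2) ^ 2) = q
      have : m ^ 2 + v x ^ 2 ≠ 0 := by positivity
      field_simp
      ring
    rw [e]
    exact mul_nonpos_of_nonneg_of_nonpos (by positivity) (by linarith)
  have h := hanti (Set.left_mem_Icc.mpr hab) (Set.right_mem_Icc.mpr hab) hab
  simp only at h
  linarith [Real.arctan_lt_pi_div_two (v a / m), Real.neg_pi_div_two_lt_arctan (v b / m)]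

theorem jacobiQ_neg (n : ℕ) (α β x : ℝ) : jacobiQ n α β (-x) = jacobiQ n β α x := by
  unfold jacobiQ
  ring

theorem jacobiQ_concave {n : ℕ} {α β a b x : ℝ} (hα : 0 < α) (hβ : 0 < β) (ha : a ≤ x)
    (hb : x ≤ b) :
    (b - x) * jacobiQ n α β a + (x - a) * jacobiQ n α β b ≤ (b - a) * jacobiQ n α β x := by
  have key : (b - a) * jacobiQ n α β x =
      (b - x) * jacobiQ n α β a + (x - a) * jacobiQ n α β b +
        ((α + β) ^ 2 + (4 * n * (n + α + β + 1) + 2 * (α + β))) *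
          ((b - a) * ((b - x) * (x - a))) := by
    unfold jacobiQ
    ring
  have : 0 ≤ (b - a) * ((b - x) * (x - a)) :=
    mul_nonneg (by linarith) (mul_nonneg (by linarith) (by linarith))
  rw [key]
  exact le_add_of_nonneg_right (mul_nonneg (by positivity) this)

theorem neg_one_lt_center_lt_one {α β : ℝ} (hα : 0 < α) (hβ : 0 < β) :
    -1 < -((α - β) / (α + β)) ∧ -((α - β) / (α + β)) < 1 := by
  rw [← neg_div, lt_div_iff₀ (by positivity), div_lt_iff₀ (by positivity)]
  constructor <;> linarith

theorem jacobiQ_center_pos {n : ℕ} {α β : ℝ} (hα : 0 < α) (hβ : 0 < β) :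
    0 < jacobiQ n α β (-((α - β) / (α + β))) := by
  have h := neg_one_lt_center_lt_one hα hβ
  have hs : (α + β) * -((α - β) / (α + β)) + (α - β) = 0 := by
    field_simp
    ring
  have hx : 0 ≤ 1 - (-((α - β) / (α + β))) ^ 2 := by nlinarith
  unfold jacobiQ
  rw [hs]
  have := mul_nonneg
    (show (0 : ℝ) ≤ 4 * n * (n + α + β + 1) + 2 * (α + β) by positivity) hx
  linarith

theorem lt_of_jacobiQ_nonpos {n : ℕ} {α β x₁ x : ℝ} (hα : 0 < α) (hβ : 0 < β)
    (hx₁ : -((α - β) / (α + β)) ≤ x₁) (hQ : jacobiQ n α β x₁ ≤ 0)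
    (hx : jacobiP n α β x = 0) : x < x₁ := by
  by_contra! hle
  have hlt : x < 1 := by
    by_contra! h
    exact (jacobiP_pos_of_one_le (by linarith) (by linarith) h).ne' hx
  refine jacobiP_ne_zero_of_jacobiQ_nonpos (by linarith) (by linarith)
    (by linarith [(neg_one_lt_center_lt_one hα hβ).1]) hlt (fun z hz _ => ?_) hx
  by_contra! hzpos
  have hc := jacobiQ_center_pos (n := n) hα hβ
  have h := jacobiQ_concave (n := n) hα hβ hx₁ (hle.trans hz.le)
  have hne : -((α - β) / (α + β)) ≠ x₁ := by
    intro e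
    rw [e] at hc
    linarith
  have h1 : 0 < x₁ - -((α - β) / (α + β)) := sub_pos.mpr (lt_of_le_of_ne hx₁ hne)
  nlinarith [mul_pos h1 hzpos, mul_nonneg (sub_nonneg.mpr (hle.trans hz.le)) hc.le]

theorem gt_of_jacobiQ_nonpos {n : ℕ} {α β x₁ x : ℝ} (hα : 0 < α) (hβ : 0 < β)
    (hx₁ : x₁ ≤ -((α - β) / (α + β))) (hQ : jacobiQ n α β x₁ ≤ 0)
    (hx : jacobiP n α β x = 0) : x₁ < x := by
  have h : -x < -x₁ := by
    refine lt_of_jacobiQ_nonpos (n := n) hβ hα ?_ ?_ ?_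
    · rw [add_comm β α, ← neg_sub α β, neg_div]
      linarith
    · rwa [jacobiQ_neg]
    · rw [jacobiP_neg, hx, mul_zero]
  linarith

section Asymptotics

variable {α β : ℕ → ℝ} {c : ℝ}

/-- The point whose rescaled coordinate is `t`. -/
noncomputable def jacobiPoint (n : ℕ) (α β t : ℝ) : ℝ :=
  Real.sqrt (n / α) * t - (α - β) / (α + β)

theorem scale_jacobiPoint {n : ℕ} {α β : ℝ} (hn : 1 ≤ n) (hα : 0 < α) (t : ℝ) :
    Real.sqrt (α / n) * (jacobiPoint n α β t + (α - β) / (α + β)) = t := by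
  have hn' : (0 : ℝ) < n := by exact_mod_cast hn
  have h : Real.sqrt (α / n) * Real.sqrt (n / α) = 1 := by
    rw [← Real.sqrt_mul (by positivity), show α / n * (n / α) = 1 by field_simp, Real.sqrt_one]
  unfold jacobiPoint
  linear_combination t * h

theorem scale_lt_iff {n : ℕ} {α β : ℝ} (hn : 1 ≤ n) (hα : 0 < α) (x t : ℝ) :
    Real.sqrt (α / n) * (x + (α - β) / (α + β)) < t ↔ x < jacobiPoint n α β t := by
  have hn' : (0 : ℝ) < n := by exact_mod_cast hn
  conv_lhs => rw [← scale_jacobiPoint (β := β) hn hα t]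
  rw [mul_lt_mul_iff_right₀ (Real.sqrt_pos.mpr (by positivity)), add_lt_add_iff_right]

theorem lt_scale_iff {n : ℕ} {α β : ℝ} (hn : 1 ≤ n) (hα : 0 < α) (x t : ℝ) :
    t < Real.sqrt (α / n) * (x + (α - β) / (α + β)) ↔ jacobiPoint n α β t < x := by
  have hn' : (0 : ℝ) < n := by exact_mod_cast hn
  conv_lhs => rw [← scale_jacobiPoint (β := β) hn hα t]
  rw [mul_lt_mul_iff_right₀ (Real.sqrt_pos.mpr (by positivity)), add_lt_add_iff_right]

theorem eventually_pos_of_div_tendsto {u : ℕ → ℝ}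
    (hu : Tendsto (fun n : ℕ => u n / n) atTop atTop) :
    ∀ᶠ n in atTop, 0 < u n := by
  filter_upwards [hu.eventually_gt_atTop 0, eventually_ge_atTop 1] with n h hn
  have hn' : (0 : ℝ) < n := by exact_mod_cast hn
  exact (div_pos_iff_of_pos_right hn').mp h

theorem tendsto_nat_div {u : ℕ → ℝ} (hu : Tendsto (fun n : ℕ => u n / n) atTop atTop) :
    Tendsto (fun n : ℕ => (n : ℝ) / u n) atTop (𝓝 0) := by
  exact hu.inv_tendsto_atTop.congr fun n => inv_div _ _

theorem tendsto_jacobiPoint (hc : 0 < c)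
    (hα : Tendsto (fun n : ℕ => α n / n) atTop atTop)
    (hβ : Tendsto (fun n : ℕ => β n / n) atTop atTop)
    (hq : Tendsto (fun n : ℕ => α n / β n) atTop (𝓝 c)) (t : ℝ) :
    Tendsto (fun n => jacobiPoint n (α n) (β n) t) atTop (𝓝 ((1 - c) / (1 + c))) := by
  have h1 : Tendsto (fun n : ℕ => Real.sqrt (n / α n) * t + (1 - α n / β n) / (1 + α n / β n))
      atTop (𝓝 (Real.sqrt 0 * t + (1 - c) / (1 + c))) :=
    ((tendsto_nat_div hα).sqrt.mul_const t).add
      ((hq.const_sub 1).div (hq.const_add 1) (by positivity))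
  rw [Real.sqrt_zero, zero_mul, zero_add] at h1
  refine h1.congr' ?_
  filter_upwards [eventually_pos_of_div_tendsto hα, eventually_pos_of_div_tendsto hβ] with n ha hb
  unfold jacobiPoint
  have : (1 - α n / β n) / (1 + α n / β n) = -((α n - β n) / (α n + β n)) := by
    field_simp
    ring
  rw [this]
  ring

theorem tendsto_jacobiQ (hc : 0 < c)
    (hα : Tendsto (fun n : ℕ => α n / n) atTop atTop)
    (hβ : Tendsto (fun n : ℕ => β n / n) atTop atTop)
    (hq : Tendsto (fun n : ℕ => α n / β n) atTop (𝓝 c)) (t : ℝ) :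
    Tendsto (fun n : ℕ => jacobiQ n (α n) (β n) (jacobiPoint n (α n) (β n) t) /
        (4 * n * (α n + β n))) atTop
      (𝓝 (4 * c / (1 + c) ^ 2 - (1 + c) / (4 * c) * t ^ 2)) := by
  have hx := tendsto_jacobiPoint hc hα hβ hq t
  have hinv : Tendsto (fun n : ℕ => (1 : ℝ) / n) atTop (𝓝 0) := tendsto_one_div_atTop_nhds_zero_nat
  have hs : Tendsto (fun n : ℕ => 1 + (α n / β n)⁻¹) atTop (𝓝 (1 + c⁻¹)) :=
    (hq.inv₀ hc.ne').const_add 1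
  have hns : Tendsto (fun n : ℕ => n / α n / (1 + (α n / β n)⁻¹)) atTop (𝓝 0) := by
    rw [← zero_div (1 + c⁻¹)]
    exact (tendsto_nat_div hα).div hs (by positivity)
  have h := ((((hns.const_add 1).add (hinv.mul hns)).add (hinv.div_const 2)).mul
    ((hx.pow 2).const_sub 1)).add (hinv.mul (hinv.mul hns)) |>.sub (hs.mul_const (t ^ 2 / 4))
  have e : (1 + 0 + 0 * 0 + 0 / 2) * (1 - ((1 - c) / (1 + c)) ^ 2) + 0 * (0 * 0) -
      (1 + c⁻¹) * (t ^ 2 / 4) = 4 * c / (1 + c) ^ 2 - (1 + c) / (4 * c) * t ^ 2 := by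
    field_simp
    ring
  rw [e] at h
  refine h.congr' ?_
  filter_upwards [eventually_pos_of_div_tendsto hα, eventually_pos_of_div_tendsto hβ,
    eventually_ge_atTop 1] with n ha hb hn
  have hn' : (0 : ℝ) < n := by exact_mod_cast hn
  have hlin : ((α n + β n) * jacobiPoint n (α n) (β n) t + (α n - β n)) ^ 2 =
      (α n + β n) ^ 2 * (n / α n) * t ^ 2 := by
    have hsq := Real.sq_sqrt (show 0 ≤ n / α n by positivity)
    have hcenter : (α n + β n) * jacobiPoint n (α n) (β n) t + (α n - β n) =
        (α n + β n) * (Real.sqrt (n / α n) * t) := by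
      unfold jacobiPoint
      field_simp
      ring
    rw [hcenter]
    linear_combination (α n + β n) ^ 2 * t ^ 2 * hsq
  unfold jacobiQ
  rw [hlin]
  field_simp
  ring

theorem jacobi_edge_pos (hc : 0 < c) : 0 < 4 * c / (1 + c) ^ ((3 : ℝ) / 2) := by positivity

theorem jacobi_limit_eq (hc : 0 < c) (t : ℝ) :
    4 * c / (1 + c) ^ 2 - (1 + c) / (4 * c) * t ^ 2 =
      (1 + c) / (4 * c) * ((4 * c / (1 + c) ^ ((3 : ℝ) / 2)) ^ 2 - t ^ 2) := by
  have h : ((1 + c) ^ ((3 : ℝ) / 2)) ^ 2 = (1 + c) ^ 3 := by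
    rw [← Real.rpow_natCast, ← Real.rpow_mul (by positivity), ← Real.rpow_natCast]
    norm_num
  rw [div_pow, h]
  field_simp

theorem eventually_jacobiQ_nonpos (hc : 0 < c)
    (hα : Tendsto (fun n : ℕ => α n / n) atTop atTop)
    (hβ : Tendsto (fun n : ℕ => β n / n) atTop atTop)
    (hq : Tendsto (fun n : ℕ => α n / β n) atTop (𝓝 c)) {t : ℝ}
    (ht : 4 * c / (1 + c) ^ ((3 : ℝ) / 2) < |t|) :
    ∀ᶠ n : ℕ in atTop, jacobiQ n (α n) (β n) (jacobiPoint n (α n) (β n) t) ≤ 0 := by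
  have hlim := tendsto_jacobiQ hc hα hβ hq t
  have hneg : 4 * c / (1 + c) ^ 2 - (1 + c) / (4 * c) * t ^ 2 < 0 := by
    rw [jacobi_limit_eq hc]
    refine mul_neg_of_pos_of_neg (by positivity) (sub_neg.mpr ?_)
    rw [sq_lt_sq, abs_of_pos (jacobi_edge_pos hc)]
    exact ht
  filter_upwards [hlim.eventually_lt_const hneg, eventually_pos_of_div_tendsto hα,
    eventually_pos_of_div_tendsto hβ, eventually_ge_atTop 1] with n h ha hb hn
  have hn' : (0 : ℝ) < n := by exact_mod_cast hn
  by_contra! hpos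
  exact absurd h (not_lt.mpr (by positivity))

theorem eventually_scaled_zeros_lt (hc : 0 < c)
    (hα : Tendsto (fun n : ℕ => α n / n) atTop atTop)
    (hβ : Tendsto (fun n : ℕ => β n / n) atTop atTop)
    (hq : Tendsto (fun n : ℕ => α n / β n) atTop (𝓝 c)) {t : ℝ}
    (ht : 4 * c / (1 + c) ^ ((3 : ℝ) / 2) < t) :
    ∀ᶠ n : ℕ in atTop, ∀ x, jacobiP n (α n) (β n) x = 0 →
      Real.sqrt (α n / n) * (x + (α n - β n) / (α n + β n)) < t := by
  have ht0 := (jacobi_edge_pos hc).trans ht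
  filter_upwards [eventually_jacobiQ_nonpos hc hα hβ hq (ht.trans_le (le_abs_self t)),
    eventually_pos_of_div_tendsto hα, eventually_pos_of_div_tendsto hβ,
    eventually_ge_atTop 1] with n h ha hb hn x hx
  rw [scale_lt_iff hn ha]
  refine lt_of_jacobiQ_nonpos ha hb ?_ h hx
  unfold jacobiPoint
  linarith [mul_nonneg (Real.sqrt_nonneg (n / α n)) ht0.le]

theorem eventually_lt_scaled_zeros (hc : 0 < c)
    (hα : Tendsto (fun n : ℕ => α n / n) atTop atTop)
    (hβ : Tendsto (fun n : ℕ => β n / n) atTop atTop)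
    (hq : Tendsto (fun n : ℕ => α n / β n) atTop (𝓝 c)) {t : ℝ}
    (ht : t < -(4 * c / (1 + c) ^ ((3 : ℝ) / 2))) :
    ∀ᶠ n : ℕ in atTop, ∀ x, jacobiP n (α n) (β n) x = 0 →
      t < Real.sqrt (α n / n) * (x + (α n - β n) / (α n + β n)) := by
  have ht0 := jacobi_edge_pos hc
  filter_upwards [eventually_jacobiQ_nonpos hc hα hβ hq ((lt_neg.mp ht).trans_le (neg_le_abs t)),
    eventually_pos_of_div_tendsto hα, eventually_pos_of_div_tendsto hβ,
    eventually_ge_atTop 1] with n h ha hb hn x hx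
  rw [lt_scale_iff hn ha]
  refine gt_of_jacobiQ_nonpos ha hb ?_ h hx
  unfold jacobiPoint
  linarith [mul_nonneg (Real.sqrt_nonneg (n / α n)) (show 0 ≤ -t by linarith)]

theorem exists_eventually_le_jacobiQ (hc : 0 < c)
    (hα : Tendsto (fun n : ℕ => α n / n) atTop atTop)
    (hβ : Tendsto (fun n : ℕ => β n / n) atTop atTop)
    (hq : Tendsto (fun n : ℕ => α n / β n) atTop (𝓝 c)) {t : ℝ}
    (ht : |t| < 4 * c / (1 + c) ^ ((3 : ℝ) / 2)) :
    ∃ δ > 0, ∀ᶠ n : ℕ in atTop, 4 * (n * (α n + β n) * δ) ≤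
      jacobiQ n (α n) (β n) (jacobiPoint n (α n) (β n) t) := by
  have hlim := tendsto_jacobiQ hc hα hβ hq t
  have hpos : 0 < 4 * c / (1 + c) ^ 2 - (1 + c) / (4 * c) * t ^ 2 := by
    rw [jacobi_limit_eq hc]
    refine mul_pos (by positivity) (sub_pos.mpr ?_)
    rw [sq_lt_sq, abs_of_pos (jacobi_edge_pos hc)]
    exact ht
  refine ⟨_, half_pos hpos, ?_⟩
  filter_upwards [hlim.eventually_const_lt (half_lt_self hpos), eventually_pos_of_div_tendsto hα,
    eventually_pos_of_div_tendsto hβ, eventually_ge_atTop 1] with n h ha hb hn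
  have hn' : (0 : ℝ) < n := by exact_mod_cast hn
  rw [lt_div_iff₀ (by positivity)] at h
  linarith

theorem eventually_exists_scaled_zero (hc : 0 < c)
    (hα : Tendsto (fun n : ℕ => α n / n) atTop atTop)
    (hβ : Tendsto (fun n : ℕ => β n / n) atTop atTop)
    (hq : Tendsto (fun n : ℕ => α n / β n) atTop (𝓝 c)) {t₁ t₂ : ℝ}
    (h₁ : -(4 * c / (1 + c) ^ ((3 : ℝ) / 2)) < t₁) (h₁₂ : t₁ < t₂)
    (h₂ : t₂ < 4 * c / (1 + c) ^ ((3 : ℝ) / 2)) :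
    ∀ᶠ n : ℕ in atTop, ∃ x, jacobiP n (α n) (β n) x = 0 ∧
      Real.sqrt (α n / n) * (x + (α n - β n) / (α n + β n)) ∈ Set.Icc t₁ t₂ := by
  obtain ⟨δ₁, hδ₁, hQ₁⟩ := exists_eventually_le_jacobiQ hc hα hβ hq
    (abs_lt.mpr ⟨h₁, h₁₂.trans h₂⟩)
  obtain ⟨δ₂, hδ₂, hQ₂⟩ := exists_eventually_le_jacobiQ hc hα hβ hq
    (abs_lt.mpr ⟨h₁.trans h₁₂, h₂⟩)
  set δ := min δ₁ δ₂ with hδ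
  have hδ0 : 0 < δ := lt_min hδ₁ hδ₂
  have hl : -1 < (1 - c) / (1 + c) := by rw [lt_div_iff₀ (by positivity)]; linarith
  have hr : (1 - c) / (1 + c) < 1 := by rw [div_lt_one (by positivity)]; linarith
  have hlen : Tendsto (fun n : ℕ => (n : ℝ) * (Real.sqrt δ * (t₂ - t₁))) atTop atTop :=
    tendsto_natCast_atTop_atTop.atTop_mul_const
      (mul_pos (Real.sqrt_pos.mpr hδ0) (sub_pos.mpr h₁₂))
  filter_upwards [hQ₁, hQ₂, eventually_pos_of_div_tendsto hα, eventually_pos_of_div_tendsto hβ,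
    eventually_ge_atTop 1, (tendsto_jacobiPoint hc hα hβ hq t₁).eventually_const_lt hl,
    (tendsto_jacobiPoint hc hα hβ hq t₂).eventually_lt_const hr,
    hlen.eventually_ge_atTop Real.pi] with n hq1 hq2 ha hb hn hx1 hx2 hpi
  have hn' : (0 : ℝ) < n := by exact_mod_cast hn
  have hsq : 0 < Real.sqrt (n / α n) := Real.sqrt_pos.mpr (by positivity)
  have hdiff : jacobiPoint n (α n) (β n) t₂ - jacobiPoint n (α n) (β n) t₁ =
      Real.sqrt (n / α n) * (t₂ - t₁) := by unfold jacobiPoint; ring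
  have hlt : jacobiPoint n (α n) (β n) t₁ < jacobiPoint n (α n) (β n) t₂ := by
    rw [← sub_pos, hdiff]
    exact mul_pos hsq (sub_pos.mpr h₁₂)
  have hm : 0 < n * (α n + β n) * δ := by positivity
  have hQ : ∀ x ∈ Set.Icc (jacobiPoint n (α n) (β n) t₁) (jacobiPoint n (α n) (β n) t₂),
      4 * Real.sqrt (n * (α n + β n) * δ) ^ 2 ≤ jacobiQ n (α n) (β n) x := by
    intro x hx
    rw [Real.sq_sqrt hm.le]
    have hA : 4 * (n * (α n + β n) * δ) ≤
        jacobiQ n (α n) (β n) (jacobiPoint n (α n) (β n) t₁) :=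
      le_trans (by gcongr; exact min_le_left _ _) hq1
    have hB : 4 * (n * (α n + β n) * δ) ≤
        jacobiQ n (α n) (β n) (jacobiPoint n (α n) (β n) t₂) :=
      le_trans (by gcongr; exact min_le_right _ _) hq2
    have hcv := jacobiQ_concave (n := n) ha hb hx.1 hx.2
    refine le_of_mul_le_mul_left ?_ (sub_pos.mpr hlt)
    linarith [mul_le_mul_of_nonneg_left hA (sub_nonneg.mpr hx.2),
      mul_le_mul_of_nonneg_left hB (sub_nonneg.mpr hx.1)]
  have hlen' : Real.pi ≤ Real.sqrt (n * (α n + β n) * δ) *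
      (jacobiPoint n (α n) (β n) t₂ - jacobiPoint n (α n) (β n) t₁) := by
    rw [hdiff, ← mul_assoc, ← Real.sqrt_mul hm.le]
    refine hpi.trans ?_
    rw [← mul_assoc]
    refine mul_le_mul_of_nonneg_right ?_ (sub_pos.mpr h₁₂).le
    refine Real.le_sqrt_of_sq_le ?_
    rw [mul_pow, Real.sq_sqrt hδ0.le]
    have : n * (α n + β n) * δ * (n / α n) = n ^ 2 * δ + n ^ 2 * δ * (β n / α n) := by
      field_simp
    rw [this]
    exact le_add_of_nonneg_right (by positivity)
  obtain ⟨x, hx, hx0⟩ := exists_jacobiP_eq_zero_of_le_jacobiQ hx1 hlt.le hx2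
    (Real.sqrt_pos.mpr hm) hQ hlen'
  refine ⟨x, hx0, ?_, ?_⟩
  · rw [← not_lt, scale_lt_iff hn ha, not_lt]
    exact hx.1
  · rw [← not_lt, lt_scale_iff hn ha, not_lt]
    exact hx.2

end Asymptotics

theorem stmt10 (α β : ℕ → ℝ) (c : ℝ) (hc : c > 0)
    (hα : ∀ n, α n > -1) (hβ : ∀ n, β n > -1)
    (hαlim : Tendsto (fun n : ℕ => α n / n) atTop atTop)
    (hβlim : Tendsto (fun n : ℕ => β n / n) atTop atTop)
    (hq : Tendsto (fun n : ℕ => α n / β n) atTop (𝓝 c))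
    (r s : ℕ → ℝ)
    (hr : ∀ n : ℕ, 1 ≤ n → IsLeast {x : ℝ | jacobiP n (α n) (β n) x = 0} (r n))
    (hs : ∀ n : ℕ, 1 ≤ n → IsGreatest {x : ℝ | jacobiP n (α n) (β n) x = 0} (s n)) :
    Tendsto (fun n : ℕ =>
        Real.sqrt (α n / n) * (r n + (α n - β n) / (α n + β n)))
      atTop (𝓝 (-(4 * c / (1 + c) ^ ((3 : ℝ) / 2)))) ∧
    Tendsto (fun n : ℕ =>
        Real.sqrt (α n / n) * (s n + (α n - β n) / (α n + β n)))
      atTop (𝓝 (4 * c / (1 + c) ^ ((3 : ℝ) / 2))) ∧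
    Set.Icc (-(4 * c / (1 + c) ^ ((3 : ℝ) / 2))) (4 * c / (1 + c) ^ ((3 : ℝ) / 2)) ⊆
      closure (⋃ n : ℕ, ⋃ _ : 1 ≤ n,
        (fun x => Real.sqrt (α n / n) * (x + (α n - β n) / (α n + β n))) ''
          {x : ℝ | jacobiP n (α n) (β n) x = 0}) := by
  set L := 4 * c / (1 + c) ^ ((3 : ℝ) / 2) with hL
  have hL0 : 0 < L := jacobi_edge_pos hc
  refine ⟨tendsto_order.mpr ⟨fun a ha => ?_, fun a ha => ?_⟩,
    tendsto_order.mpr ⟨fun a ha => ?_, fun a ha => ?_⟩, fun t ht => ?_⟩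
  · filter_upwards [eventually_lt_scaled_zeros hc hαlim hβlim hq ha,
      eventually_ge_atTop 1] with n h hn using h _ (hr n hn).1
  · obtain ⟨t₂, h₂, h₂'⟩ := exists_between (show -L < min a L from lt_min ha (by linarith))
    obtain ⟨t₁, h₁, h₁'⟩ := exists_between h₂
    filter_upwards [eventually_exists_scaled_zero hc hαlim hβlim hq h₁ h₁'
      (h₂'.trans_le (min_le_right _ _)), eventually_ge_atTop 1] with n ⟨x, hx, hmem⟩ hn
    refine lt_of_le_of_lt ?_ (hmem.2.trans_lt (h₂'.trans_le (min_le_left _ _)))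
    gcongr
    exact (hr n hn).2 hx
  · obtain ⟨t₁, h₁, h₁'⟩ := exists_between (show max a (-L) < L from max_lt ha (by linarith))
    obtain ⟨t₂, h₂, h₂'⟩ := exists_between h₁'
    filter_upwards [eventually_exists_scaled_zero hc hαlim hβlim hq
      ((le_max_right _ _).trans_lt h₁) h₂ h₂', eventually_ge_atTop 1] with n ⟨x, hx, hmem⟩ hn
    refine lt_of_lt_of_le (((le_max_left _ _).trans_lt h₁).trans_le hmem.1) ?_
    gcongr
    exact (hs n hn).2 hx
  · filter_upwards [eventually_scaled_zeros_lt hc hαlim hβlim hq ha,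
      eventually_ge_atTop 1] with n h hn using h _ (hs n hn).1
  · rw [Metric.mem_closure_iff]
    intro ε hε
    obtain ⟨t₁, h₁, h₁'⟩ := exists_between (show max (t - ε) (-L) < min (t + ε) L from
      max_lt (lt_min (by linarith) (by linarith [ht.2])) (lt_min (by linarith [ht.1])
        (by linarith)))
    obtain ⟨t₂, h₂, h₂'⟩ := exists_between h₁'
    obtain ⟨n, ⟨x, hx, hmem⟩, hn⟩ := ((eventually_exists_scaled_zero hc hαlim hβlim hq
      ((le_max_right _ _).trans_lt h₁) h₂ (h₂'.trans_le (min_le_right _ _))).and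
        (eventually_ge_atTop 1)).exists
    refine ⟨_, Set.mem_iUnion₂.mpr ⟨n, hn, x, hx, rfl⟩, ?_⟩
    rw [dist_comm, Real.dist_eq, abs_lt]
    have := (le_max_left _ _).trans_lt h₁
    have := h₂'.trans_le (min_le_left _ _)
    constructor <;> linarith [hmem.1, hmem.2]
end
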